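/- arXiv:2506.00423 — 2 statements merged into one kernel-verified Lean document; each statement's English description precedes it below -/
import Mathlib

section
/- Assume p ≥ 5. Let e ≥ 0 be an integer, q = p^e, and define φ*(t) = [[1, t^q, (1/2)t^{2q}, (1/6)t^{3q}], [0, 1, t^q, (1/2)t^{2q}], [0, 0, 1, t^q], [0, 0, 0, 1]] and ω*(u) = diag(u^{3q}, u^{q}, u^{−q}, u^{−3q}). Let σ : SL(2,k) → SL(4,k) be a homomorphism of algebraic groups such that σ([[1,t],[0,1]]) = φ*(t) for all t ∈ k and σ([[u,0],[0,u⁻¹]]) = ω*(u) for all u ∈ kˣ. Then for every [[a,b],[c,d]] ∈ SL(2,k), σ([[a,b],[c,d]]) = [[a^{3q}, a^{2q}b^{q}, (1/2)a^{q}b^{2q}, (1/6)b^{3q}], [3a^{2q}c^{q}, a^{q}(ad+2bc)^{q}, b^{q}(ad+(1/2)bc)^{q}, (1/2)b^{2q}d^{q}], [6a^{q}c^{2q}, 4c^{q}(ad+(1/2)bc)^{q}, d^{q}(ad+2bc)^{q}, b^{q}d^{2q}], [6c^{3q}, 6c^{2q}d^{q}, 3c^{q}d^{2q}, d^{3q}]].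 -/
open Matrix

/-- The unipotent one-parameter subgroup `φ*` of form (I). -/
noncomputable def phiStarI (k : Type*) [Field k] (q : ℕ) (t : k) : Matrix (Fin 4) (Fin 4) k :=
  !![1, t ^ q, (1 / 2 : k) * t ^ (2 * q), (1 / 6 : k) * t ^ (3 * q);
     0, 1, t ^ q, (1 / 2 : k) * t ^ (2 * q);
     0, 0, 1, t ^ q;
     0, 0, 0, 1]

/-- The cocharacter `ω*(u) = diag(u^{3q}, u^{q}, u^{−q}, u^{−3q})` of form (I). -/
noncomputable def omegaStarI (k : Type*) [Field k] (q : ℕ) (u : kˣ) :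
    Matrix (Fin 4) (Fin 4) k :=
  Matrix.diagonal
    ![(u : k) ^ (3 * q : ℤ), (u : k) ^ (q : ℤ), (u : k) ^ (-(q : ℤ)), (u : k) ^ (-(3 * q : ℤ))]

/-- The explicit extension `σ*` of form (I)* to all of `SL(2,k)`. -/
noncomputable def sigmaStarI (k : Type*) [Field k] (q : ℕ)
    (A : SpecialLinearGroup (Fin 2) k) : Matrix (Fin 4) (Fin 4) k :=
  let a := A.1 0 0
  let b := A.1 0 1
  let c := A.1 1 0
  let d := A.1 1 1
  !![a ^ (3 * q), a ^ (2 * q) * b ^ q, (1 / 2 : k) * (a ^ q * b ^ (2 * q)),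
       (1 / 6 : k) * b ^ (3 * q);
     3 * (a ^ (2 * q) * c ^ q), a ^ q * (a * d + 2 * (b * c)) ^ q,
       b ^ q * (a * d + (1 / 2 : k) * (b * c)) ^ q, (1 / 2 : k) * (b ^ (2 * q) * d ^ q);
     6 * (a ^ q * c ^ (2 * q)), 4 * (c ^ q * (a * d + (1 / 2 : k) * (b * c)) ^ q),
       d ^ q * (a * d + 2 * (b * c)) ^ q, b ^ q * d ^ (2 * q);
     6 * c ^ (3 * q), 6 * (c ^ (2 * q) * d ^ q), 3 * (c ^ q * d ^ (2 * q)), d ^ (3 * q)]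

section FormI

variable {k : Type*} [Field k]

/-- The action of `!![a, b; c, d]` on binary cubic forms, in the basis adapted to `φ*`. -/
noncomputable def cubicMatrix (a b c d : k) : Matrix (Fin 4) (Fin 4) k :=
  !![a ^ 3, a ^ 2 * b, (1 / 2 : k) * (a * b ^ 2), (1 / 6 : k) * b ^ 3;
     3 * (a ^ 2 * c), a * (a * d + 2 * (b * c)), b * (a * d + (1 / 2 : k) * (b * c)),
       (1 / 2 : k) * (b ^ 2 * d);
     6 * (a * c ^ 2), 4 * (c * (a * d + (1 / 2 : k) * (b * c))), d * (a * d + 2 * (b * c)),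
       b * d ^ 2;
     6 * c ^ 3, 6 * (c ^ 2 * d), 3 * (c * d ^ 2), d ^ 3]

lemma phiStarI_eq_cubicMatrix (q : ℕ) (t : k) :
    phiStarI k q t = cubicMatrix 1 (t ^ q) 0 1 := by
  ext i j
  fin_cases i <;> fin_cases j <;> simp [phiStarI, cubicMatrix, pow_mul']

lemma omegaStarI_eq_cubicMatrix (q : ℕ) (u : kˣ) :
    omegaStarI k q u = cubicMatrix ((u : k) ^ q) 0 0 ((u : k) ^ q)⁻¹ := by
  have h3 : (u : k) ^ (3 * q : ℤ) = ((u : k) ^ q) ^ 3 := by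
    rw [← pow_mul']; exact_mod_cast rfl
  ext i j
  fin_cases i <;> fin_cases j <;> simp [omegaStarI, cubicMatrix, h3]

/-- Exponentiation by `p ^ e` fixes the prime subfield, so it passes through the entries. -/
lemma sigmaStarI_eq_cubicMatrix (p : ℕ) [Fact p.Prime] [CharP k p] (e : ℕ)
    (A : SpecialLinearGroup (Fin 2) k) :
    sigmaStarI k (p ^ e) A = cubicMatrix (A.1 0 0 ^ p ^ e) (A.1 0 1 ^ p ^ e)
      (A.1 1 0 ^ p ^ e) (A.1 1 1 ^ p ^ e) := by
  have h2 : (2 : k) ^ p ^ e = 2 := by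
    simpa [iterateFrobenius_def] using map_ofNat (iterateFrobenius k p e) 2
  have hadd (x y : k) : (x + y) ^ p ^ e = x ^ p ^ e + y ^ p ^ e := add_pow_char_pow x y p e
  ext i j
  fin_cases i <;> fin_cases j <;>
    simp [sigmaStarI, cubicMatrix, pow_mul', hadd, mul_pow, h2]

/-- A matrix that inverts a torus element with pairwise distinct weights is antidiagonal. -/
lemma eq_antidiagonal_of_mul_cubicMatrix {v : k} (hv : v ≠ 0) (hv12 : v ^ 12 ≠ 1)
    {M : Matrix (Fin 4) (Fin 4) k}
    (hM : M * cubicMatrix v 0 0 v⁻¹ = cubicMatrix v⁻¹ 0 0 v * M) :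
    M = !![0, 0, 0, M 0 3; 0, 0, M 1 2, 0; 0, M 2 1, 0, 0; M 3 0, 0, 0, 0] := by
  have h2 : v ^ 2 - 1 ≠ 0 := fun h => hv12 (by
    linear_combination (v ^ 10 + v ^ 8 + v ^ 6 + v ^ 4 + v ^ 2 + 1) * h)
  have h4 : v ^ 4 - 1 ≠ 0 := fun h => hv12 (by linear_combination (v ^ 8 + v ^ 4 + 1) * h)
  have h6 : v ^ 6 - 1 ≠ 0 := fun h => hv12 (by linear_combination (v ^ 6 + 1) * h)
  ext i j
  have h := congrFun (congrFun hM i) j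
  fin_cases i <;> fin_cases j <;>
    simp [cubicMatrix, Matrix.mul_apply, Fin.sum_univ_four] at h ⊢ <;> field_simp at h <;>
    first
    | exact (mul_eq_zero.mp (show (v ^ 2 - 1) * _ = 0 by linear_combination h)).resolve_left h2
    | exact (mul_eq_zero.mp (show (v ^ 2 - 1) * _ = 0 by linear_combination -h)).resolve_left h2
    | exact (mul_eq_zero.mp (show (v ^ 4 - 1) * _ = 0 by linear_combination h)).resolve_left h4
    | exact (mul_eq_zero.mp (show (v ^ 4 - 1) * _ = 0 by linear_combination -h)).resolve_left h4
    | exact (mul_eq_zero.mp (show (v ^ 6 - 1) * _ = 0 by linear_combination h)).resolve_left h6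
    | exact (mul_eq_zero.mp (show (v ^ 6 - 1) * _ = 0 by linear_combination -h)).resolve_left h6

/-- The braid relation between the Weyl element and the unipotent subgroup pins down the image
of the Weyl element. -/
lemma eq_cubicMatrix_of_braid (h2 : (2 : k) ≠ 0) (h3 : (3 : k) ≠ 0) {α β γ δ : k} (hδ : δ ≠ 0)
    (h : cubicMatrix 1 1 0 1 * !![0, 0, 0, α; 0, 0, β, 0; 0, γ, 0, 0; δ, 0, 0, 0] *
        cubicMatrix 1 1 0 1 =
      !![0, 0, 0, α; 0, 0, β, 0; 0, γ, 0, 0; δ, 0, 0, 0] * cubicMatrix 1 (-1) 0 1 *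
        !![0, 0, 0, α; 0, 0, β, 0; 0, γ, 0, 0; δ, 0, 0, 0]) :
    !![0, 0, 0, α; 0, 0, β, 0; 0, γ, 0, 0; δ, 0, 0, 0] = cubicMatrix 0 1 (-1) 0 := by
  have h6 : (6 : k)⁻¹ = 2⁻¹ * 3⁻¹ := by rw [← mul_inv]; norm_num
  have e0 := congrFun (congrFun h 0) 0
  have e1 := congrFun (congrFun h 0) 1
  have e2 := congrFun (congrFun h 0) 2
  have e3 := congrFun (congrFun h 0) 3
  simp [cubicMatrix, Matrix.mul_apply, Fin.sum_univ_four, h6, hδ] at e0 e1 e2 e3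
  have hx := mul_inv_cancel₀ h2
  have hy := mul_inv_cancel₀ h3
  simp only [cubicMatrix, one_div, h6]
  generalize (2 : k)⁻¹ = x at *
  generalize (3 : k)⁻¹ = y at *
  obtain rfl : γ = -(y * δ) := by linear_combination 2 * e1 - (γ + y * δ) * hx
  obtain rfl : β = x ^ 2 * y * δ := by linear_combination e2 - e1 - x * y * δ * hx
  subst e0
  have hxy : x * y ≠ 0 := fun h0 => one_ne_zero (α := k) (by
    linear_combination 6 * h0 - hx - 2 * x * hy)
  obtain rfl : δ = -6 := mul_left_cancel₀ hxy (mul_left_cancel₀ hxy (by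
    linear_combination e3 + x * y * (hx + 2 * x * hy)))
  ext i j
  fin_cases i <;> fin_cases j <;> simp
  · linear_combination x * (hx + 2 * x * hy)
  · linear_combination 2 * hy - 2 * hx
  · norm_num

/-- Bruhat decomposition of the big cell. -/
lemma cubicMatrix_bigCell (h2 : (2 : k) ≠ 0) (h3 : (3 : k) ≠ 0) {a b c d : k} (hc : c ≠ 0)
    (hdet : a * d - b * c = 1) :
    cubicMatrix 1 (a / c) 0 1 * cubicMatrix 0 1 (-1) 0 * cubicMatrix (-c) 0 0 (-c)⁻¹ *
      cubicMatrix 1 (d / c) 0 1 = cubicMatrix a b c d := by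
  obtain rfl : b = (a * d - 1) / c := by field_simp; linear_combination -hdet
  have h6 : (6 : k) ≠ 0 := by
    rw [show (6 : k) = 2 * 3 by norm_num]; exact mul_ne_zero h2 h3
  ext i j
  fin_cases i <;> fin_cases j <;>
    simp [cubicMatrix, Matrix.mul_apply, Fin.sum_univ_four] <;> field_simp <;> ring

lemma cubicMatrix_borel {a b d : k} (hdet : a * d = 1) :
    cubicMatrix a 0 0 a⁻¹ * cubicMatrix 1 (b / a) 0 1 = cubicMatrix a b 0 d := by
  have ha : a ≠ 0 := left_ne_zero_of_mul_eq_one hdet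
  obtain rfl : d = a⁻¹ := eq_inv_of_mul_eq_one_right hdet
  ext i j
  fin_cases i <;> fin_cases j <;>
    simp [cubicMatrix, Matrix.mul_apply, Fin.sum_univ_four] <;> field_simp

lemma exists_unit_pow_ne_one [Infinite k] {n : ℕ} (hn : n ≠ 0) : ∃ u : kˣ, (u : k) ^ n ≠ 1 := by
  classical
  obtain ⟨u, hu⟩ := Infinite.exists_notMem_finset
    (insert 0 (Polynomial.X ^ n - 1 : Polynomial k).roots.toFinset)
  simp only [Finset.mem_insert, not_or, Multiset.mem_toFinset] at hu
  refine ⟨Units.mk0 u hu.1, fun h => hu.2 ?_⟩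
  rw [Polynomial.mem_roots (by simpa using
    Polynomial.X_pow_sub_C_ne_zero (Nat.pos_of_ne_zero hn) (1 : k))]
  simpa [sub_eq_zero] using h

end FormI

/-- If `p ≥ 5` and the algebraic group homomorphism
`σ : SL(2,k) → SL(4,k)` restricts on the upper unipotent subgroup and the torus to the
data `φ*`, `ω*` of form (I), then `σ` is given by the explicit formula `σ*` of (I)*. -/
theorem stmt9 {k : Type*} [Field k] [IsAlgClosed k] {p : ℕ} [Fact p.Prime] [CharP k p]
    (hp : 5 ≤ p) (e : ℕ)
    (σ : SpecialLinearGroup (Fin 2) k →* SpecialLinearGroup (Fin 4) k)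
    (hpoly : ∀ i j : Fin 4, ∃ P : MvPolynomial (Fin 2 × Fin 2) k,
      ∀ A : SpecialLinearGroup (Fin 2) k,
        (σ A).1 i j = MvPolynomial.eval (fun x => A.1 x.1 x.2) P)
    (hupper : ∀ t : k,
      (σ ⟨!![1, t; 0, 1], by simp [Matrix.det_fin_two_of]⟩).1 = phiStarI k (p ^ e) t)
    (hdiag : ∀ u : kˣ,
      (σ ⟨!![(u : k), 0; 0, ((u⁻¹ : kˣ) : k)], by simp [Matrix.det_fin_two_of]⟩).1 =
        omegaStarI k (p ^ e) u) :
    ∀ A : SpecialLinearGroup (Fin 2) k, (σ A).1 = sigmaStarI k (p ^ e) A := by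
  have : Infinite k := IsAlgClosed.instInfinite
  have hprime : p.Prime := Fact.out
  have h2 : (2 : k) ≠ 0 := by
    have := (CharP.cast_eq_zero_iff k p 2).not.mpr (Nat.not_dvd_of_pos_of_lt (by norm_num) (by lia))
    exact_mod_cast this
  have h3 : (3 : k) ≠ 0 := by
    have := (CharP.cast_eq_zero_iff k p 3).not.mpr (Nat.not_dvd_of_pos_of_lt (by norm_num) (by lia))
    exact_mod_cast this
  have hq : p ^ e ≠ 0 := pow_ne_zero _ hprime.ne_zero
  have hneg : (-1 : k) ^ p ^ e = -1 := by
    simpa [iterateFrobenius_def] using map_neg (iterateFrobenius k p e) 1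
  simp only [phiStarI_eq_cubicMatrix] at hupper
  simp only [omegaStarI_eq_cubicMatrix] at hdiag
  let w : SpecialLinearGroup (Fin 2) k := ⟨!![0, 1; -1, 0], by simp [Matrix.det_fin_two_of]⟩
  let x (t : k) : SpecialLinearGroup (Fin 2) k :=
    ⟨!![1, t; 0, 1], by simp [Matrix.det_fin_two_of]⟩
  let y (u : kˣ) : SpecialLinearGroup (Fin 2) k :=
    ⟨!![(u : k), 0; 0, ((u⁻¹ : kˣ) : k)], by simp [Matrix.det_fin_two_of]⟩
  have hx (t : k) : (σ (x t)).1 = cubicMatrix 1 (t ^ p ^ e) 0 1 := hupper t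
  have hy (u : kˣ) : (σ (y u)).1 = cubicMatrix ((u : k) ^ p ^ e) 0 0 ((u : k) ^ p ^ e)⁻¹ := hdiag u
  have hmul (A B : SpecialLinearGroup (Fin 2) k) : (σ (A * B)).1 = (σ A).1 * (σ B).1 := by
    rw [map_mul]; rfl
  have hw : (σ w).1 = cubicMatrix 0 1 (-1) 0 := by
    obtain ⟨u, hu⟩ := exists_unit_pow_ne_one (k := k) (mul_ne_zero hq (show 12 ≠ 0 by norm_num))
    have htorus : w * y u = y u⁻¹ * w := by
      refine Subtype.ext ?_
      change w.1 * (y u).1 = (y u⁻¹).1 * w.1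
      ext i j
      fin_cases i <;> fin_cases j <;> simp [Matrix.mul_apply, w, y]
    have hbraid : x 1 * w * x 1 = w * x (-1) * w := by
      refine Subtype.ext ?_
      change (x 1).1 * w.1 * (x 1).1 = w.1 * (x (-1)).1 * w.1
      ext i j
      fin_cases i <;> fin_cases j <;> simp [Matrix.mul_apply, w, x]
    have hanti := eq_antidiagonal_of_mul_cubicMatrix (pow_ne_zero (p ^ e) u.ne_zero)
      (by rwa [← pow_mul]) (M := (σ w).1) (by
        have := congrArg (fun A => (σ A).1) htorus
        simpa only [hmul, hy, Units.val_inv_eq_inv_val, inv_pow, inv_inv] using this)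
    have hdelta : (σ w).1 3 0 ≠ 0 := fun h0 => by
      have hdet := (σ w).2
      rw [hanti, h0, Matrix.det_eq_zero_of_row_eq_zero 3 (by
        intro j; fin_cases j <;> simp)] at hdet
      exact zero_ne_one hdet
    rw [hanti]
    refine eq_cubicMatrix_of_braid h2 h3 hdelta ?_
    rw [← hanti]
    have := congrArg (fun A => (σ A).1) hbraid
    simpa only [hmul, hx, one_pow, hneg] using this
  intro A
  have hdet : A.1 0 0 * A.1 1 1 - A.1 0 1 * A.1 1 0 = 1 := by
    rw [← Matrix.det_fin_two]; exact A.2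
  have hdet_pow : A.1 0 0 ^ p ^ e * A.1 1 1 ^ p ^ e - A.1 0 1 ^ p ^ e * A.1 1 0 ^ p ^ e = 1 := by
    rw [← mul_pow, ← mul_pow, ← sub_pow_char_pow, hdet, one_pow]
  rw [sigmaStarI_eq_cubicMatrix]
  by_cases hc : A.1 1 0 = 0
  · rw [hc] at hdet hdet_pow ⊢
    rw [zero_pow hq] at hdet_pow ⊢
    rw [mul_zero, sub_zero] at hdet hdet_pow
    have ha : A.1 0 0 ≠ 0 := left_ne_zero_of_mul_eq_one hdet
    have hA : A = y (Units.mk0 _ ha) * x (A.1 0 1 / A.1 0 0) := by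
      refine Subtype.ext ?_
      change A.1 = (y _).1 * (x _).1
      ext i j
      fin_cases i <;> fin_cases j <;> simp [Matrix.mul_apply, x, y, hc]
      · field_simp
      · exact eq_inv_of_mul_eq_one_right hdet
    rw [← cubicMatrix_borel hdet_pow]
    conv_lhs => rw [hA, hmul, hx, hy]
    simp only [Units.val_mk0, div_pow]
  · have hA : A = x (A.1 0 0 / A.1 1 0) * w * y (-Units.mk0 _ hc) * x (A.1 1 1 / A.1 1 0) := by
      refine Subtype.ext ?_
      change A.1 = (x _).1 * w.1 * (y _).1 * (x _).1
      ext i j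
      fin_cases i <;> fin_cases j <;> simp [Matrix.mul_apply, x, y, w]
      all_goals field_simp
      linear_combination -hdet
    have hneg_c : (-A.1 1 0) ^ p ^ e = -(A.1 1 0 ^ p ^ e) := by rw [neg_pow, hneg, neg_one_mul]
    rw [← cubicMatrix_bigCell h2 h3 (pow_ne_zero _ hc) hdet_pow]
    conv_lhs => rw [hA, hmul, hmul, hmul, hx, hx, hy, hw]
    simp only [Units.val_neg, Units.val_mk0, div_pow, hneg_c]
end

section
/- Assume p ≥ 5. Every homomorphism of algebraic groups σ : SL(2,k) → SL(4,k) is equivalent to exactly one homomorphism in the following list; in particular, any two distinct members of the list (belonging to different items, or to the same item with different parameter values) are inequivalent. Writing A = [[a,b],[c,d]] ∈ SL(2,k) and q = p^e: (I) for each integer e ≥ 0, the map A ↦ [[a^{3q}, a^{2q}b^{q}, a^{q}b^{2q}, b^{3q}], [3a^{2q}c^{q}, a^{q}(a^{q}d^{q}+2b^{q}c^{q}), b^{q}(2a^{q}d^{q}+b^{q}c^{q}), 3b^{2q}d^{q}], [3a^{q}c^{2q}, c^{q}(2a^{q}d^{q}+b^{q}c^{q}), d^{q}(a^{q}d^{q}+2b^{q}c^{q}),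 3b^{q}d^{2q}], [c^{3q}, c^{2q}d^{q}, c^{q}d^{2q}, d^{3q}]]; (IV) for each pair of integers e₂ > e₁ ≥ 0, the map A ↦ A^{(p^{e₂})} ⊗ A^{(p^{e₁})}; (IX) for each integer e ≥ 0, the block-diagonal map A ↦ diag(M(A), 1) where M(A) = [[a^{2q}, a^{q}b^{q}, b^{2q}], [2a^{q}c^{q}, a^{q}d^{q}+b^{q}c^{q}, 2b^{q}d^{q}], [c^{2q}, c^{q}d^{q}, d^{2q}]]; (XV) for each pair of integers e₂ ≥ e₃ ≥ 0, the block-diagonal map A ↦ diag(A^{(p^{e₂})}, A^{(p^{e₃})}); (XXIV) for each integer e ≥ 0, the block-diagonal map A ↦ diag(A^{(p^{e})}, 1, 1); (XXVI) the constant map A ↦ I₄. -/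
open Matrix

/-- Entrywise `m`-th power of a 2×2 matrix: `A^{(m)} = [[a^m, b^m],[c^m, d^m]]`. -/
noncomputable def entryPow {k : Type*} [Field k] (A : Matrix (Fin 2) (Fin 2) k) (m : ℕ) :
    Matrix (Fin 2) (Fin 2) k :=
  Matrix.of fun i j => A i j ^ m

/-- The Kronecker product of two 2×2 matrices as a 4×4 matrix in 2×2 blocks. -/
noncomputable def kron4 {k : Type*} [Field k] (X Y : Matrix (Fin 2) (Fin 2) k) :
    Matrix (Fin 4) (Fin 4) k :=
  !![X 0 0 * Y 0 0, X 0 0 * Y 0 1, X 0 1 * Y 0 0, X 0 1 * Y 0 1;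
     X 0 0 * Y 1 0, X 0 0 * Y 1 1, X 0 1 * Y 1 0, X 0 1 * Y 1 1;
     X 1 0 * Y 0 0, X 1 0 * Y 0 1, X 1 1 * Y 0 0, X 1 1 * Y 0 1;
     X 1 0 * Y 1 0, X 1 0 * Y 1 1, X 1 1 * Y 1 0, X 1 1 * Y 1 1]

/-- The block-diagonal 4×4 matrix `diag(X, Y)` built from two 2×2 matrices. -/
noncomputable def blockDiag4 {k : Type*} [Field k] (X Y : Matrix (Fin 2) (Fin 2) k) :
    Matrix (Fin 4) (Fin 4) k :=
  !![X 0 0, X 0 1, 0, 0;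
     X 1 0, X 1 1, 0, 0;
     0, 0, Y 0 0, Y 0 1;
     0, 0, Y 1 0, Y 1 1]

/-- Family (I): the Frobenius twist of the irreducible 4-dimensional representation. -/
noncomputable def famI (k : Type*) [Field k] (q : ℕ)
    (A : SpecialLinearGroup (Fin 2) k) : Matrix (Fin 4) (Fin 4) k :=
  let a := A.1 0 0
  let b := A.1 0 1
  let c := A.1 1 0
  let d := A.1 1 1
  !![a ^ (3 * q), a ^ (2 * q) * b ^ q, a ^ q * b ^ (2 * q), b ^ (3 * q);
     3 * (a ^ (2 * q) * c ^ q), a ^ q * (a ^ q * d ^ q + 2 * (b ^ q * c ^ q)),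
       b ^ q * (2 * (a ^ q * d ^ q) + b ^ q * c ^ q), 3 * (b ^ (2 * q) * d ^ q);
     3 * (a ^ q * c ^ (2 * q)), c ^ q * (2 * (a ^ q * d ^ q) + b ^ q * c ^ q),
       d ^ q * (a ^ q * d ^ q + 2 * (b ^ q * c ^ q)), 3 * (b ^ q * d ^ (2 * q));
     c ^ (3 * q), c ^ (2 * q) * d ^ q, c ^ q * d ^ (2 * q), d ^ (3 * q)]

/-- Family (IX): the twisted adjoint representation plus a trivial summand. -/
noncomputable def famIX (k : Type*) [Field k] (q : ℕ)
    (A : SpecialLinearGroup (Fin 2) k) : Matrix (Fin 4) (Fin 4) k :=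
  let a := A.1 0 0
  let b := A.1 0 1
  let c := A.1 1 0
  let d := A.1 1 1
  !![a ^ (2 * q), a ^ q * b ^ q, b ^ (2 * q), 0;
     2 * (a ^ q * c ^ q), a ^ q * d ^ q + b ^ q * c ^ q, 2 * (b ^ q * d ^ q), 0;
     c ^ (2 * q), c ^ q * d ^ q, d ^ (2 * q), 0;
     0, 0, 0, 1]

/-- Entrywise polynomial condition: each matrix entry of `σ(A)` is a fixed polynomial
in the four entries of `A`. -/
def IsPolyEntries {k : Type*} [Field k]
    (σ : SpecialLinearGroup (Fin 2) k → Matrix (Fin 4) (Fin 4) k) : Prop :=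
  ∀ i j : Fin 4, ∃ P : MvPolynomial (Fin 2 × Fin 2) k,
    ∀ A : SpecialLinearGroup (Fin 2) k,
      σ A i j = MvPolynomial.eval (fun x => A.1 x.1 x.2) P

/-- Equivalence of matrix-valued maps on `SL(2,k)`: conjugacy by some `P ∈ GL(4,k)`. -/
def MatEquiv {k : Type*} [Field k]
    (f g : SpecialLinearGroup (Fin 2) k → Matrix (Fin 4) (Fin 4) k) : Prop :=
  ∃ P : GL (Fin 4) k, ∀ A : SpecialLinearGroup (Fin 2) k,
    ((P⁻¹ : GL (Fin 4) k) : Matrix (Fin 4) (Fin 4) k) * f A *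
      (P : Matrix (Fin 4) (Fin 4) k) = g A

/-- The index set of the classification list for `p ≥ 5`. -/
inductive Idx13 : Type
  | I : ℕ → Idx13
  | IV : (e₁ e₂ : ℕ) → e₁ < e₂ → Idx13
  | IX : ℕ → Idx13
  | XV : (e₂ e₃ : ℕ) → e₃ ≤ e₂ → Idx13
  | XXIV : ℕ → Idx13
  | XXVI : Idx13

/-- The classification list of homomorphisms `SL(2,k) → SL(4,k)` for `p ≥ 5`. -/
noncomputable def list13 {k : Type*} [Field k] (p : ℕ) :
    Idx13 → SpecialLinearGroup (Fin 2) k → Matrix (Fin 4) (Fin 4) k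
  | Idx13.I e => famI k (p ^ e)
  | Idx13.IV e₁ e₂ _ => fun A => kron4 (entryPow A.1 (p ^ e₂)) (entryPow A.1 (p ^ e₁))
  | Idx13.IX e => famIX k (p ^ e)
  | Idx13.XV e₂ e₃ _ => fun A => blockDiag4 (entryPow A.1 (p ^ e₂)) (entryPow A.1 (p ^ e₃))
  | Idx13.XXIV e => fun A => blockDiag4 (entryPow A.1 (p ^ e)) 1
  | Idx13.XXVI => fun _ => 1

open Polynomial

section Generators

variable {k : Type*} [Field k]

/-- The upper unipotent element `[[1, s], [0, 1]]`. -/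
def upperUni (s : k) : SpecialLinearGroup (Fin 2) k := ⟨!![1, s; 0, 1], by simp⟩

/-- The lower unipotent element `[[1, 0], [s, 1]]`. -/
def lowerUni (s : k) : SpecialLinearGroup (Fin 2) k := ⟨!![1, 0; s, 1], by simp⟩

/-- The Weyl element `[[0, 1], [-1, 0]]`. -/
def weyl (k : Type*) [Field k] : SpecialLinearGroup (Fin 2) k := ⟨!![0, 1; -1, 0], by simp⟩

/-- The torus element `diag(t, t⁻¹)`. -/
def torus (t : k) (ht : t ≠ 0) : SpecialLinearGroup (Fin 2) k := ⟨!![t, 0; 0, t⁻¹], by simp [ht]⟩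

@[simp] lemma coe_torus (t : k) (ht : t ≠ 0) : (torus t ht).1 = !![t, 0; 0, t⁻¹] := rfl

@[simp] lemma coe_upperUni (s : k) : (upperUni s).1 = !![1, s; 0, 1] := rfl

@[simp] lemma coe_lowerUni (s : k) : (lowerUni s).1 = !![1, 0; s, 1] := rfl

@[simp] lemma coe_weyl : (weyl k).1 = !![0, 1; -1, 0] := rfl

lemma upperUni_zero : upperUni (0 : k) = 1 := by
  apply Subtype.ext
  simp [Matrix.one_fin_two]

lemma upperUni_add (s t : k) : upperUni (s + t) = upperUni s * upperUni t := by
  apply Subtype.ext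
  simp [add_comm]

lemma upperUni_mul_neg (s : k) : upperUni s * upperUni (-s) = 1 := by
  rw [← upperUni_add, add_neg_cancel, upperUni_zero]

lemma upperUni_neg_mul (s : k) : upperUni (-s) * upperUni s = 1 := by
  rw [← upperUni_add, neg_add_cancel, upperUni_zero]

lemma weyl_conj_upperUni (s : k) : weyl k * upperUni s * (weyl k)⁻¹ = lowerUni (-s) := by
  rw [mul_inv_eq_iff_eq_mul]
  apply Subtype.ext
  simp

lemma weyl_conj_lowerUni (s : k) : weyl k * lowerUni s * (weyl k)⁻¹ = upperUni (-s) := by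
  rw [mul_inv_eq_iff_eq_mul]
  apply Subtype.ext
  simp

lemma weyl_eq : upperUni (1 : k) * lowerUni (-1) * upperUni 1 = weyl k := by
  apply Subtype.ext
  simp

lemma upperUni_conj_lowerUni (s r : k) (h : 1 + s * r ≠ 0) :
    upperUni s * lowerUni r * upperUni (-s) =
      lowerUni (r * (1 + s * r)⁻¹) * (upperUni (1 + s * r) * lowerUni (-(1 + s * r)⁻¹) *
        upperUni (1 + s * r) * (weyl k)⁻¹) * upperUni (-s ^ 2 * (r * (1 + s * r)⁻¹)) := by
  have htorus : upperUni (1 + s * r) * lowerUni (-(1 + s * r)⁻¹) * upperUni (1 + s * r) *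
      (weyl k)⁻¹ = torus _ h := by
    apply Subtype.ext
    simp [Matrix.adjugate_fin_two, h]
  rw [htorus]
  have h' : 1 + r * s ≠ 0 := by rwa [mul_comm r s]
  apply Subtype.ext
  ext i j
  fin_cases i <;> fin_cases j <;> simp <;> field_simp <;> ring1

lemma sl2_induction {motive : SpecialLinearGroup (Fin 2) k → Prop}
    (hu : ∀ s, motive (upperUni s)) (hl : ∀ s, motive (lowerUni s))
    (hm : ∀ g h, motive g → motive h → motive (g * h)) (g : SpecialLinearGroup (Fin 2) k) :
    motive g := by
  have key : ∀ g : SpecialLinearGroup (Fin 2) k, g.1 1 0 ≠ 0 → motive g := by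
    intro g hg
    have hd := g.det_coe
    rw [Matrix.det_fin_two] at hd
    have : g = upperUni ((g.1 0 0 - 1) / g.1 1 0) * lowerUni (g.1 1 0) *
        upperUni ((g.1 1 1 - 1) / g.1 1 0) := by
      apply Subtype.ext
      ext i j
      fin_cases i <;> fin_cases j <;> simp <;> field_simp <;>
        first | ring1 | linear_combination -hd
    rw [this]
    exact hm _ _ (hm _ _ (hu _) (hl _)) (hu _)
  by_cases hg : g.1 1 0 = 0
  · have hd := g.det_coe
    rw [Matrix.det_fin_two, hg, mul_zero, sub_zero] at hd
    have h1 : g = (g * lowerUni 1) * lowerUni (-1) := by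
      rw [mul_assoc]
      convert (mul_one g).symm
      apply Subtype.ext
      simp [Matrix.one_fin_two]
    rw [h1]
    refine hm _ _ (key _ ?_) (hl _)
    have : g.1 1 1 ≠ 0 := right_ne_zero_of_mul (hd ▸ one_ne_zero)
    simpa [SpecialLinearGroup.coe_mul, Matrix.mul_apply, Fin.sum_univ_two, hg] using this
  · exact key g hg

end Generators

section RationalDerivative

variable {k : Type*} [Field k]

/-- `f` agrees near `0` with a rational function having value `a` and derivative `b` at `0`. -/
def HasRatDeriv (f : k → k) (a b : k) : Prop :=
  ∃ P D : k[X], D.eval 0 ≠ 0 ∧ (∀ r, D.eval r ≠ 0 → f r * D.eval r = P.eval r) ∧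
    P.eval 0 = a * D.eval 0 ∧
    (derivative P).eval 0 = a * (derivative D).eval 0 + b * D.eval 0

lemma HasRatDeriv.unique [Infinite k] {f : k → k} {a b a' b' : k} (h : HasRatDeriv f a b)
    (h' : HasRatDeriv f a' b') : a = a' ∧ b = b' := by
  obtain ⟨P, D, hD, hf, h0, h1⟩ := h
  obtain ⟨P', D', hD', hf', h0', h1'⟩ := h'
  have hz : D * D' * (P * D' - P' * D) = 0 := by
    apply Polynomial.funext
    intro r
    by_cases hr : D.eval r = 0
    · simp [hr]
    by_cases hr' : D'.eval r = 0
    · simp [hr']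
    simp only [eval_mul, eval_sub, ← hf r hr, ← hf' r hr', eval_zero]
    ring
  have hDD : D * D' ≠ 0 := fun h => by
    have := congrArg (eval 0) h
    simp [hD, hD'] at this
  have heq := (mul_eq_zero.1 hz).resolve_left hDD
  have e0 := congrArg (eval 0) heq
  have e1 := congrArg (fun q => eval 0 (derivative q)) heq
  simp only [eval_mul, eval_sub, derivative_mul, derivative_sub, eval_add, h0, h1, h0', h1',
    eval_zero, derivative_zero] at e0 e1
  have ha : a = a' := by
    have : (a - a') * (D.eval 0 * D'.eval 0) = 0 := by linear_combination e0
    exact sub_eq_zero.1 ((mul_eq_zero.1 this).resolve_right (mul_ne_zero hD hD'))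
  subst ha
  refine ⟨rfl, ?_⟩
  have : (b - b') * (D.eval 0 * D'.eval 0) = 0 := by linear_combination e1
  exact sub_eq_zero.1 ((mul_eq_zero.1 this).resolve_right (mul_ne_zero hD hD'))

lemma HasRatDeriv.congr_of_ne {f g : k → k} {a b : k} (h : HasRatDeriv f a b) (D₀ : k[X])
    (h0 : D₀.eval 0 ≠ 0) (hfg : ∀ r, D₀.eval r ≠ 0 → f r = g r) : HasRatDeriv g a b := by
  obtain ⟨P, D, hD, hf, hP, hP'⟩ := h
  refine ⟨P * D₀, D * D₀, by simp [hD, h0], ?_, by simp [hP]; ring, ?_⟩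
  · intro r hr
    rw [eval_mul] at hr
    rw [← hfg r (right_ne_zero_of_mul hr), eval_mul, eval_mul,
      ← hf r (left_ne_zero_of_mul hr)]
    ring
  · simp [hP, hP']; ring

lemma hasRatDeriv_const (c : k) : HasRatDeriv (fun _ => c) c 0 :=
  ⟨C c, 1, by simp, by simp, by simp, by simp⟩

lemma hasRatDeriv_id : HasRatDeriv (fun r : k => r) 0 1 :=
  ⟨X, 1, by simp, by simp, by simp, by simp⟩

lemma HasRatDeriv.mul {f g : k → k} {a b a' b' : k} (h : HasRatDeriv f a b)
    (h' : HasRatDeriv g a' b') : HasRatDeriv (fun r => f r * g r) (a * a') (b * a' + a * b') := by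
  obtain ⟨P, D, hD, hf, h0, h1⟩ := h
  obtain ⟨P', D', hD', hf', h0', h1'⟩ := h'
  refine ⟨P * P', D * D', by simp [hD, hD'], ?_, by simp [h0, h0']; ring, ?_⟩
  · intro r hr
    rw [eval_mul] at hr
    rw [eval_mul, eval_mul, ← hf r (left_ne_zero_of_mul hr), ← hf' r (right_ne_zero_of_mul hr)]
    ring
  · simp [h0, h0', h1, h1']; ring

lemma HasRatDeriv.add {f g : k → k} {a b a' b' : k} (h : HasRatDeriv f a b)
    (h' : HasRatDeriv g a' b') : HasRatDeriv (fun r => f r + g r) (a + a') (b + b') := by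
  obtain ⟨P, D, hD, hf, h0, h1⟩ := h
  obtain ⟨P', D', hD', hf', h0', h1'⟩ := h'
  refine ⟨P * D' + P' * D, D * D', by simp [hD, hD'], ?_, by simp [h0, h0']; ring, ?_⟩
  · intro r hr
    rw [eval_mul] at hr
    rw [eval_mul, eval_add, eval_mul, eval_mul, ← hf r (left_ne_zero_of_mul hr),
      ← hf' r (right_ne_zero_of_mul hr)]
    ring
  · simp [h0, h0', h1, h1']; ring

lemma HasRatDeriv.inv {f : k → k} {b : k} (h : HasRatDeriv f 1 b) :
    HasRatDeriv (fun r => (f r)⁻¹) 1 (-b) := by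
  obtain ⟨P, D, hD, hf, h0, h1⟩ := h
  refine ⟨D * D, P * D, by simp [h0, hD], ?_, by simp [h0], ?_⟩
  · intro r hr
    rw [eval_mul] at hr
    have hD := right_ne_zero_of_mul hr
    have hP := left_ne_zero_of_mul hr
    rw [← hf r hD] at hP
    have hf0 := left_ne_zero_of_mul hP
    rw [eval_mul, eval_mul, ← hf r hD]
    field_simp
  · simp [h0, h1]; ring

lemma HasRatDeriv.eval_comp {f : k → k} {a b : k} (h : HasRatDeriv f a b) (Q : k[X]) :
    HasRatDeriv (fun r => Q.eval (f r)) (Q.eval a) (b * (derivative Q).eval a) := by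
  induction Q using Polynomial.induction_on with
  | C c => simpa using hasRatDeriv_const c
  | add p q hp hq => simpa [mul_add] using hp.add hq
  | monomial n c ih =>
    have := ih.mul h
    convert this using 1
    · ext r; simp [pow_succ, mul_assoc]
    · simp [pow_succ, mul_assoc]
    · rw [pow_succ, ← mul_assoc, derivative_mul (g := X)]
      simp; ring

lemma HasRatDeriv.sum {ι : Type*} (s : Finset ι) {f : ι → k → k} {a b : ι → k}
    (h : ∀ i ∈ s, HasRatDeriv (f i) (a i) (b i)) :
    HasRatDeriv (fun r => ∑ i ∈ s, f i r) (∑ i ∈ s, a i) (∑ i ∈ s, b i) := by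
  classical
  induction s using Finset.induction_on with
  | empty => simpa using hasRatDeriv_const (0 : k)
  | insert i s hi ih =>
    simp only [Finset.sum_insert hi]
    exact (h i (Finset.mem_insert_self _ _)).add
      (ih fun j hj => h j (Finset.mem_insert_of_mem hj))

variable {n : Type*}

/-- Entrywise version of `HasRatDeriv` for matrix-valued functions. -/
def HasMatDeriv (f : k → Matrix n n k) (a b : Matrix n n k) : Prop :=
  ∀ i j, HasRatDeriv (fun r => f r i j) (a i j) (b i j)

lemma HasMatDeriv.unique [Infinite k] {f : k → Matrix n n k} {a b a' b' : Matrix n n k}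
    (h : HasMatDeriv f a b) (h' : HasMatDeriv f a' b') : b = b' := by
  ext i j; exact ((h i j).unique (h' i j)).2

lemma hasMatDeriv_const (c : Matrix n n k) : HasMatDeriv (fun _ => c) c 0 :=
  fun i j => hasRatDeriv_const (c i j)

lemma HasMatDeriv.mul [Fintype n] {f g : k → Matrix n n k} {a b a' b' : Matrix n n k}
    (h : HasMatDeriv f a b) (h' : HasMatDeriv g a' b') :
    HasMatDeriv (fun r => f r * g r) (a * a') (b * a' + a * b') := by
  intro i j
  simp only [Matrix.mul_apply, Matrix.add_apply, ← Finset.sum_add_distrib]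
  exact HasRatDeriv.sum _ fun l _ => (h i l).mul (h' l j)

lemma HasRatDeriv.map_eval {f : k → k} {a b : k} (h : HasRatDeriv f a b) (U : Matrix n n k[X]) :
    HasMatDeriv (fun r => U.map (eval (f r))) (U.map (eval a))
      (b • U.map fun q => (derivative q).eval a) := by
  intro i j
  simpa using h.eval_comp (U i j)

end RationalDerivative

section LieAlgebra

variable {k : Type*} [Field k] {n : Type*}

/-- The value at `a` of the derivative of a matrix of polynomials. -/
noncomputable def derivAt (U : Matrix n n k[X]) (a : k) : Matrix n n k :=
  U.map fun q => (derivative q).eval a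

/-- The linear coefficient of a matrix of polynomials. -/
noncomputable def linCoeff (U : Matrix n n k[X]) : Matrix n n k :=
  U.map fun q => q.coeff 1

lemma derivAt_zero (U : Matrix n n k[X]) : derivAt U 0 = linCoeff U := by
  ext i j
  simp [derivAt, linCoeff, ← coeff_zero_eq_eval_zero, coeff_derivative]

variable [Fintype n] [DecidableEq n]

/-- The relations by which the infinitesimal generators `E`, `F` of a representation `σ` of
`SL(2,k)` are tied to `σ` and to each other. -/
structure IsInfinitesimal (σ : SpecialLinearGroup (Fin 2) k →* Matrix n n k)
    (E F : Matrix n n k) : Prop where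
  upper_E : ∀ s, σ (upperUni s) * E = E * σ (upperUni s)
  upper_F : ∀ s, σ (upperUni s) * F = (F + s • (E * F - F * E) - s ^ 2 • E) * σ (upperUni s)
  lower_F : ∀ s, σ (lowerUni s) * F = F * σ (lowerUni s)
  lower_E : ∀ s, σ (lowerUni s) * E = (E - s • (E * F - F * E) - s ^ 2 • F) * σ (lowerUni s)

variable {σ : SpecialLinearGroup (Fin 2) k →* Matrix n n k} {U : Matrix n n k[X]}

lemma map_weyl_mul_inv : σ (weyl k) * σ (weyl k)⁻¹ = 1 := by
  rw [← map_mul, mul_inv_cancel, map_one]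

lemma map_weyl_inv_mul : σ (weyl k)⁻¹ * σ (weyl k) = 1 := by
  rw [← map_mul, inv_mul_cancel, map_one]

lemma map_lowerUni (r : k) :
    σ (lowerUni r) = σ (weyl k) * σ (upperUni (-r)) * σ (weyl k)⁻¹ := by
  rw [← map_mul, ← map_mul, weyl_conj_upperUni, neg_neg]

lemma HasRatDeriv.map_upperUni (hU : ∀ s, σ (upperUni s) = U.map (eval s)) {f : k → k} {a b : k}
    (h : HasRatDeriv f a b) :
    HasMatDeriv (fun r => σ (upperUni (f r))) (σ (upperUni a)) (b • derivAt U a) := by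
  simp only [hU]
  exact h.map_eval U

lemma HasRatDeriv.neg {f : k → k} {a b : k} (h : HasRatDeriv f a b) :
    HasRatDeriv (fun r => -f r) (-a) (-b) := by
  simpa using (hasRatDeriv_const (-1)).mul h

lemma HasRatDeriv.map_lowerUni (hU : ∀ s, σ (upperUni s) = U.map (eval s)) {f : k → k} {a b : k}
    (h : HasRatDeriv f a b) :
    HasMatDeriv (fun r => σ (lowerUni (f r))) (σ (lowerUni a))
      (b • -(σ (weyl k) * derivAt U (-a) * σ (weyl k)⁻¹)) := by
  simp only [_root_.map_lowerUni]
  convert ((hasMatDeriv_const (σ (weyl k))).mul (h.neg.map_upperUni hU)).mul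
    (hasMatDeriv_const (σ (weyl k)⁻¹)) using 1
  simp

/-- The infinitesimal generator of the lower unipotent subgroup. -/
noncomputable def lowerGen (σ : SpecialLinearGroup (Fin 2) k →* Matrix n n k)
    (U : Matrix n n k[X]) : Matrix n n k :=
  -(σ (weyl k) * linCoeff U * σ (weyl k)⁻¹)

lemma derivAt_eq [Infinite k] (hU : ∀ s, σ (upperUni s) = U.map (eval s)) (s : k) :
    derivAt U s = linCoeff U * σ (upperUni s) ∧ derivAt U s = σ (upperUni s) * linCoeff U := by
  have h1 := ((hasRatDeriv_id (k := k)).add (hasRatDeriv_const s)).map_upperUni hU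
  have h2 := ((hasRatDeriv_id (k := k)).map_upperUni hU).mul
    (hasMatDeriv_const (σ (upperUni s)))
  have h3 := (hasMatDeriv_const (σ (upperUni s))).mul
    ((hasRatDeriv_id (k := k)).map_upperUni hU)
  simp only [upperUni_add, map_mul] at h1
  constructor
  · simpa [derivAt_zero] using h1.unique h2
  · simp only [← map_mul, ← upperUni_add, add_comm s] at h3
    simp only [← map_mul, ← upperUni_add] at h1
    simpa [derivAt_zero] using h1.unique h3

lemma conj_lowerGen [Infinite k] (hU : ∀ s, σ (upperUni s) = U.map (eval s)) :
    ∃ H : Matrix n n k, ∀ s, σ (upperUni s) * lowerGen σ U * σ (upperUni (-s)) =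
      lowerGen σ U + s • H - s ^ 2 • linCoeff U := by
  refine ⟨derivAt U 1 * (σ (lowerUni (-1)) * σ (upperUni 1) * σ (weyl k)⁻¹) +
    σ (upperUni 1) * ((-(σ (weyl k) * derivAt U 1 * σ (weyl k)⁻¹)) * σ (upperUni 1) +
      σ (lowerUni (-1)) * derivAt U 1) * σ (weyl k)⁻¹, fun s => ?_⟩
  have hl := (hasRatDeriv_id (k := k)).map_lowerUni hU
  have hL := ((hasMatDeriv_const (σ (upperUni s))).mul hl).mul
    (hasMatDeriv_const (σ (upperUni (-s))))
  have hy := (hasRatDeriv_const (1 : k)).add ((hasRatDeriv_const s).mul hasRatDeriv_id)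
  simp only [mul_zero, add_zero, mul_one, zero_add] at hy
  have hx := (hasRatDeriv_id (k := k)).mul hy.inv
  have hR := ((hx.map_lowerUni hU).mul (((((hy.map_upperUni hU).mul (hy.inv.neg.map_lowerUni hU)).mul
    (hy.map_upperUni hU)).mul (hasMatDeriv_const (σ (weyl k)⁻¹))))).mul
    (((hasRatDeriv_const (-s ^ 2)).mul hx).map_upperUni hU)
  have hL' := fun i j => (hL i j).congr_of_ne (C 1 + C s * X) (by simp)
    (g := fun r => (σ (lowerUni (r * (1 + s * r)⁻¹)) * (σ (upperUni (1 + s * r)) *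
      σ (lowerUni (-(1 + s * r)⁻¹)) * σ (upperUni (1 + s * r)) * σ (weyl k)⁻¹) *
      σ (upperUni (-s ^ 2 * (r * (1 + s * r)⁻¹)))) i j) (fun r hr => by
        simp only [← map_mul]
        rw [upperUni_conj_lowerUni s r (by simpa using hr)])
  have hz : lowerUni (0 : k) = 1 := by
    have := weyl_conj_upperUni (0 : k)
    rwa [upperUni_zero, mul_one, mul_inv_cancel, neg_zero, eq_comm] at this
  have hw : σ (upperUni 1) * σ (lowerUni (-1)) * σ (upperUni 1) * σ (weyl k)⁻¹ = 1 := by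
    rw [← map_mul, ← map_mul, ← map_mul, weyl_eq, mul_inv_cancel, map_one]
  have := HasMatDeriv.unique (b := _) (b' := _) hL' hR
  simp only [mul_zero, zero_mul, add_zero, zero_add, mul_one, one_mul, hz, upperUni_zero, map_one,
    neg_zero, derivAt_zero, one_smul, hw, neg_neg, neg_mul, mul_neg] at this
  rw [lowerGen, mul_neg, neg_mul, this, sub_eq_add_neg]
  congr 1
  · congr 1
    simp only [smul_add, Matrix.smul_mul, Matrix.mul_smul, Matrix.add_mul, Matrix.mul_add,
      Matrix.mul_assoc, smul_neg, mul_neg, neg_mul]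
    abel
  · simp

lemma isInfinitesimal [Infinite k] (hU : ∀ s, σ (upperUni s) = U.map (eval s)) :
    IsInfinitesimal σ (linCoeff U) (lowerGen σ U) ∧
      (linCoeff U * lowerGen σ U - lowerGen σ U * linCoeff U) * linCoeff U -
        linCoeff U * (linCoeff U * lowerGen σ U - lowerGen σ U * linCoeff U) =
          (2 : k) • linCoeff U ∧
      (linCoeff U * lowerGen σ U - lowerGen σ U * linCoeff U) * lowerGen σ U -
        lowerGen σ U * (linCoeff U * lowerGen σ U - lowerGen σ U * linCoeff U) =
          (-2 : k) • lowerGen σ U := by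
  obtain ⟨H, hH⟩ := conj_lowerGen hU
  have hE : ∀ s, σ (upperUni s) * linCoeff U = linCoeff U * σ (upperUni s) := fun s => by
    rw [← (derivAt_eq hU s).1, ← (derivAt_eq hU s).2]
  set E := linCoeff U with hEdef
  set F := lowerGen σ U with hFdef
  have hneg : ∀ s, σ (upperUni (-s)) * σ (upperUni s) = 1 := fun s => by
    rw [← map_mul, upperUni_neg_mul, map_one]
  have hF : ∀ s, σ (upperUni s) * F = (F + s • H - s ^ 2 • E) * σ (upperUni s) := fun s => by
    rw [← hH s, mul_assoc, hneg, mul_one]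
  have hd : ∀ s, derivAt U s * F = (H - (2 * s) • E) * σ (upperUni s) +
      (F + s • H - s ^ 2 • E) * derivAt U s := by
    intro s
    have hid := (hasRatDeriv_const s).add hasRatDeriv_id
    have h1 := (hid.map_upperUni hU).mul (hasMatDeriv_const F)
    have hG : HasMatDeriv (fun r => F + (s + r) • H - (s + r) ^ 2 • E)
        (F + s • H - s ^ 2 • E) (H - (2 * s) • E) := by
      intro i j
      have := ((hasRatDeriv_const (F i j)).add (hid.mul (hasRatDeriv_const (H i j)))).add
        (((hid.mul hid).mul (hasRatDeriv_const (E i j))).neg)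
      convert this using 1
      · ext r; simp; ring
      · simp; ring
      · simp; ring
    have h2 := hG.mul (hid.map_upperUni hU)
    simp only [hF] at h1
    simpa using h1.unique h2
  have hEF : E * F - F * E = H := by
    have := hd 0
    rw [derivAt_zero, upperUni_zero, map_one] at this
    simp only [mul_zero, zero_smul, sub_zero, mul_one, add_zero, ne_eq, OfNat.ofNat_ne_zero,
      not_false_eq_true, zero_pow] at this
    rw [this]; abel
  have hHE : H * E - E * H = (2 : k) • E := by
    have := hd 1
    rw [(derivAt_eq hU 1).1, mul_assoc, hF, ← mul_assoc, ← mul_assoc, ← add_mul] at this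
    have h2 := congrArg (· * σ (upperUni (-1))) this
    simp only [mul_assoc, ← map_mul, upperUni_mul_neg, map_one, mul_one, one_smul, one_pow,
      mul_add, mul_sub, add_mul, sub_mul] at h2
    rw [← hEF] at h2 ⊢
    rw [← sub_eq_zero] at h2 ⊢
    rw [← neg_eq_zero, ← h2]
    abel
  have hW1 : σ (weyl k) * σ (weyl k)⁻¹ = 1 := map_weyl_mul_inv
  have hW2 : σ (weyl k)⁻¹ * σ (weyl k) = 1 := map_weyl_inv_mul
  set W := σ (weyl k)
  set W' := σ (weyl k)⁻¹
  have hWE : W * E = -(F * W) := by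
    simp only [hFdef, lowerGen, neg_mul, neg_neg]
    rw [mul_assoc _ _ W, hW2, mul_one]
  have hWF : W * F = -(E * W) := by
    have h1 := ((hasMatDeriv_const W).mul ((hasRatDeriv_id (k := k)).map_lowerUni hU)).mul
      (hasMatDeriv_const W')
    have h2 := (hasRatDeriv_id (k := k)).neg.map_upperUni hU
    simp only [W, W', ← map_mul, weyl_conj_lowerUni] at h1
    have := h1.unique h2
    simp only [neg_zero, derivAt_zero, zero_mul, zero_add, mul_zero, add_zero, one_smul,
      neg_smul] at this
    have h3 := congrArg (· * W) this
    simp only [neg_mul] at h3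
    rw [← h3]
    simp only [mul_assoc]
    rw [hW2]
    simp only [mul_one, hFdef, lowerGen, mul_assoc]
    rfl
  have hWH : W * H = -(H * W) := by
    rw [← hEF, mul_sub, ← mul_assoc, ← mul_assoc, hWE, hWF, neg_mul, neg_mul, mul_assoc, mul_assoc,
      hWE, hWF]
    noncomm_ring
  have hcancel : ∀ A B : Matrix n n k, A * W = B * W → A = B := fun A B h => by
    have := congrArg (· * W') h
    simpa [mul_assoc, hW1] using this
  have hWu : ∀ s, W * σ (upperUni (-s)) = σ (lowerUni s) * W := fun s => by
    rw [map_lowerUni s, mul_assoc _ _ W]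
    rw [hW2, mul_one]
  refine ⟨⟨hE, fun s => by rw [hEF, hF], fun s => ?_, fun s => ?_⟩, by rw [hEF, hHE], ?_⟩
  · have h := congrArg (W * ·) (hE (-s))
    simp only [← mul_assoc] at h
    rw [hWu, hWE, neg_mul, mul_assoc, mul_assoc, hWu, hWE, mul_neg, neg_inj, ← mul_assoc,
      ← mul_assoc] at h
    exact hcancel _ _ h
  · have h := congrArg (W * ·) (hF (-s))
    simp only [← mul_assoc] at h
    rw [hWu, mul_assoc, hWF, mul_sub, mul_add, mul_smul_comm, mul_smul_comm, hWE, hWF, hWH] at h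
    apply hcancel
    rw [hEF, mul_assoc, mul_assoc, ← hWu]
    have h' := congrArg Neg.neg h
    simp only [mul_neg, neg_neg] at h'
    rw [h', ← mul_assoc, ← neg_mul]
    congr 1
    simp only [sub_mul, smul_mul_assoc, neg_smul, smul_neg, neg_sq]
    abel
  · apply hcancel
    rw [hEF]
    have h := congrArg (W * ·) hHE
    simp only [mul_sub, ← mul_assoc, mul_smul_comm] at h
    rw [hWE, hWH] at h
    simp only [neg_mul, mul_assoc, hWE, hWH] at h
    simp only [sub_mul, smul_mul_assoc, mul_assoc]
    simp only [mul_neg, neg_neg, smul_neg] at h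
    rw [neg_smul, ← h]

lemma coeff_succ_smul [Infinite k] (hU : ∀ s, σ (upperUni s) = U.map (eval s)) (m : ℕ) :
    ((m + 1 : ℕ) : k) • U.map (fun q => q.coeff (m + 1)) =
      linCoeff U * U.map (fun q => q.coeff m) := by
  have hpoly : U.map derivative = (linCoeff U).map C * U := by
    ext1 i j
    apply Polynomial.funext
    intro s
    have := congrFun₂ (derivAt_eq hU s).1 i j
    rw [hU] at this
    simpa [derivAt, Matrix.mul_apply, eval_finsetSum] using this
  ext i j
  have := congrArg (fun q : k[X] => q.coeff m) (congrFun₂ hpoly i j)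
  simpa [Matrix.mul_apply, coeff_derivative, finsetSum_coeff, mul_comm] using this

lemma coeff_zero_eq_one (hU : ∀ s, σ (upperUni s) = U.map (eval s)) :
    U.map (fun q => q.coeff 0) = 1 := by
  rw [← map_one σ, ← upperUni_zero, hU]
  ext i j
  simp [coeff_zero_eq_eval_zero]

lemma isNilpotent_linCoeff [Infinite k] (p : ℕ) [Fact p.Prime] [CharP k p]
    (hU : ∀ s, σ (upperUni s) = U.map (eval s)) : IsNilpotent (linCoeff U) := by
  have h : ∀ m : ℕ, linCoeff U ^ m = (m.factorial : k) • U.map (fun q => q.coeff m) := by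
    intro m
    induction m with
    | zero => simpa using (coeff_zero_eq_one hU).symm
    | succ m ih =>
      rw [pow_succ', ih, mul_smul_comm, ← coeff_succ_smul hU, smul_smul, Nat.factorial_succ,
        Nat.cast_mul, mul_comm]
  refine ⟨p, ?_⟩
  rw [h, (CharP.cast_eq_zero_iff k p _).2 (Nat.dvd_factorial (Fact.out : p.Prime).pos le_rfl),
    zero_smul]

end LieAlgebra

section Twist

variable {k : Type*} [Field k] {n : Type*} [Fintype n] [DecidableEq n]

lemma eq_one_of_upperUni {σ : SpecialLinearGroup (Fin 2) k →* Matrix n n k}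
    (h : ∀ s, σ (upperUni s) = 1) : σ = 1 := by
  ext1 g
  induction g using sl2_induction with
  | hu s => exact h s
  | hl s =>
    rw [map_lowerUni, h, mul_one, map_weyl_mul_inv]
    rfl
  | hm g g' hg hg' => rw [map_mul, map_mul, hg, hg']

variable (p : ℕ) [Fact p.Prime] [CharP k p]

/-- The Frobenius endomorphism of `SL(2,k)`. -/
noncomputable def frob : SpecialLinearGroup (Fin 2) k →* SpecialLinearGroup (Fin 2) k :=
  SpecialLinearGroup.map (frobenius k p)

lemma frob_apply (g : SpecialLinearGroup (Fin 2) k) (i j : Fin 2) :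
    (frob p g).1 i j = g.1 i j ^ p := rfl

variable [IsAlgClosed k]

lemma exists_untwist {σ : SpecialLinearGroup (Fin 2) k →* Matrix n n k} {U : Matrix n n k[X]}
    (hU : ∀ s, σ (upperUni s) = U.map (eval s)) (hE : linCoeff U = 0) :
    ∃ (σ' : SpecialLinearGroup (Fin 2) k →* Matrix n n k) (U' : Matrix n n k[X]),
      (∀ s, σ' (upperUni s) = U'.map (eval s)) ∧
      (∀ i j, (U i j).natDegree = (U' i j).natDegree * p) ∧ ∀ g, σ g = σ' (frob p g) := by
  have hp : p ≠ 0 := (Fact.out : p.Prime).ne_zero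
  have hder : ∀ i j, derivative (U i j) = 0 := by
    intro i j
    apply Polynomial.funext
    intro s
    have := congrFun₂ (derivAt_eq hU s).1 i j
    simpa [derivAt, hE] using this
  have hexp : ∀ i j, expand k p (contract p (U i j)) = U i j := fun i j =>
    expand_contract p (hder i j) hp
  let φ : SpecialLinearGroup (Fin 2) k →* SpecialLinearGroup (Fin 2) k :=
    SpecialLinearGroup.map ((frobeniusEquiv k p).symm : k →+* k)
  refine ⟨σ.comp φ, U.map (contract p), fun s => ?_, fun i j => ?_, fun g => ?_⟩
  · have h1 : φ (upperUni s) = upperUni ((frobeniusEquiv k p).symm s) := by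
      apply Subtype.ext
      ext i j
      fin_cases i <;> fin_cases j <;> simp [φ]
    rw [MonoidHom.comp_apply, h1, hU]
    ext i j
    rw [Matrix.map_apply, ← hexp i j, expand_eval, frobeniusEquiv_symm_pow_p]
    simp
  · rw [Matrix.map_apply, ← natDegree_expand, hexp]
  · have h1 : φ (frob p g) = g := by
      apply Subtype.ext
      ext i j
      exact frobeniusEquiv_symm_apply_frobenius k p (g.1 i j)
    rw [MonoidHom.comp_apply, h1]

theorem twist_induction {motive : (SpecialLinearGroup (Fin 2) k →* Matrix n n k) → Prop}
    (trivial : motive 1)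
    (twist : ∀ σ σ', motive σ' → (∀ g, σ g = σ' (frob p g)) → motive σ)
    (base : ∀ σ (U : Matrix n n k[X]), (∀ s, σ (upperUni s) = U.map (eval s)) →
      linCoeff U ≠ 0 → motive σ)
    (σ : SpecialLinearGroup (Fin 2) k →* Matrix n n k) (U : Matrix n n k[X])
    (hU : ∀ s, σ (upperUni s) = U.map (eval s)) : motive σ := by
  have key : ∀ (N : ℕ) (σ : SpecialLinearGroup (Fin 2) k →* Matrix n n k) (U : Matrix n n k[X]),
      (∀ s, σ (upperUni s) = U.map (eval s)) → (∀ i j, (U i j).natDegree ≤ N) → motive σ := by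
    intro N
    induction N with
    | zero =>
      intro σ U hU hdeg
      convert trivial
      apply eq_one_of_upperUni
      intro s
      rw [← map_one σ, ← upperUni_zero, hU, hU]
      ext i j
      rw [Matrix.map_apply, Matrix.map_apply, eq_C_of_natDegree_le_zero (hdeg i j), eval_C, eval_C]
    | succ N ih =>
      intro σ U hU hdeg
      by_cases hE : linCoeff U = 0
      · obtain ⟨σ', U', hU', hdeg', hσ'⟩ := exists_untwist p hU hE
        refine twist σ σ' (ih σ' U' hU' fun i j => ?_) hσ'
        have h1 := hdeg i j
        rw [hdeg' i j] at h1
        have h2 := (Fact.out : p.Prime).two_le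
        by_contra! h3
        nlinarith
      · exact base σ U hU hE
  refine key (∑ i, ∑ j, (U i j).natDegree) σ U hU fun i j => ?_
  exact (Finset.single_le_sum (f := fun j => (U i j).natDegree) (fun _ _ => Nat.zero_le _)
    (Finset.mem_univ j)).trans (Finset.single_le_sum (f := fun i => ∑ j, (U i j).natDegree)
      (fun _ _ => Nat.zero_le _) (Finset.mem_univ i))

end Twist

section Conjugation

variable {k : Type*} [Field k] {n : Type*} [Fintype n] [DecidableEq n]

/-- The representation conjugate to `σ` by `P`. -/
def conjRep (P : GL n k) (σ : SpecialLinearGroup (Fin 2) k →* Matrix n n k) :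
    SpecialLinearGroup (Fin 2) k →* Matrix n n k where
  toFun g := (P⁻¹).1 * σ g * P.1
  map_one' := by simp
  map_mul' g h := by
    have hP : P.1 * (P⁻¹).1 = 1 := Units.mul_inv P
    calc (P⁻¹).1 * σ (g * h) * P.1 = (P⁻¹).1 * σ g * 1 * σ h * P.1 := by
          rw [map_mul, mul_one, mul_assoc _ (σ g)]
      _ = _ := by rw [← hP]; simp only [mul_assoc]

lemma conjRep_apply (P : GL n k) (σ : SpecialLinearGroup (Fin 2) k →* Matrix n n k) (g) :
    conjRep P σ g = (P⁻¹).1 * σ g * P.1 := rfl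

lemma conjRep_upperUni {σ : SpecialLinearGroup (Fin 2) k →* Matrix n n k} {U : Matrix n n k[X]}
    (hU : ∀ s, σ (upperUni s) = U.map (eval s)) (P : GL n k) :
    ∀ s, conjRep P σ (upperUni s) = ((P⁻¹).1.map C * U * P.1.map C).map (eval s) := by
  intro s
  rw [conjRep_apply, hU]
  ext i j
  simp [Matrix.mul_apply, eval_finsetSum]

lemma linCoeff_conj (U : Matrix n n k[X]) (P : GL n k) :
    linCoeff ((P⁻¹).1.map C * U * P.1.map C) = (P⁻¹).1 * linCoeff U * P.1 := by
  ext i j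
  simp [linCoeff, Matrix.mul_apply, finsetSum_coeff]

lemma conj_eq_of_mul_eq {P : GL n k} {A B : Matrix n n k} (h : A * P.1 = P.1 * B) :
    (P⁻¹).1 * A * P.1 = B := by
  rw [mul_assoc, h, ← mul_assoc]
  have hP : (P⁻¹).1 * P.1 = 1 := Units.inv_mul P
  rw [hP, one_mul]

lemma lowerGen_conj (σ : SpecialLinearGroup (Fin 2) k →* Matrix n n k) (U : Matrix n n k[X])
    (P : GL n k) : lowerGen (conjRep P σ) ((P⁻¹).1.map C * U * P.1.map C) =
      (P⁻¹).1 * lowerGen σ U * P.1 := by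
  have hP : P.1 * (P⁻¹).1 = 1 := Units.mul_inv P
  have h : ∀ A : Matrix n n k, P.1 * ((P⁻¹).1 * A) = A := fun A => by
    rw [← mul_assoc, hP, one_mul]
  rw [lowerGen, lowerGen, linCoeff_conj]
  simp only [conjRep_apply, mul_neg, neg_mul, mul_assoc, h]

lemma exists_factor {σ τ : SpecialLinearGroup (Fin 2) k →* Matrix n n k} {E F : Matrix n n k}
    (hσ : IsInfinitesimal σ E F) (hτ : IsInfinitesimal τ E F)
    (hC : ∀ c : Matrix n n k, c * E = E * c → c * F = F * c → ∀ g, c * τ g = τ g * c) :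
    ∃ ρ : SpecialLinearGroup (Fin 2) k →* Matrix n n k,
      (∀ g, σ g = τ g * ρ g) ∧ ∀ g, ρ g * E = E * ρ g ∧ ρ g * F = F * ρ g := by
  have inv1 : ∀ g, τ g⁻¹ * τ g = 1 := fun g => by rw [← map_mul, inv_mul_cancel, map_one]
  have inv2 : ∀ g, τ g * τ g⁻¹ = 1 := fun g => by rw [← map_mul, mul_inv_cancel, map_one]
  have comm : ∀ (g) (X Y : Matrix n n k), σ g * X = Y * σ g → τ g * X = Y * τ g →
      τ g⁻¹ * σ g * X = X * (τ g⁻¹ * σ g) := by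
    intro g X Y h1 h2
    have h3 : τ g⁻¹ * Y = X * τ g⁻¹ := by
      calc τ g⁻¹ * Y = τ g⁻¹ * (Y * τ g) * τ g⁻¹ := by rw [mul_assoc, mul_assoc, inv2, mul_one]
        _ = X * τ g⁻¹ := by rw [← h2, ← mul_assoc, inv1, one_mul]
    rw [mul_assoc, h1, ← mul_assoc, h3, mul_assoc]
  have key : ∀ g, τ g⁻¹ * σ g * E = E * (τ g⁻¹ * σ g) ∧ τ g⁻¹ * σ g * F = F * (τ g⁻¹ * σ g) := by
    intro g
    induction g using sl2_induction with
    | hu s => exact ⟨comm _ _ _ (hσ.upper_E s) (hτ.upper_E s),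
        comm _ _ _ (hσ.upper_F s) (hτ.upper_F s)⟩
    | hl s => exact ⟨comm _ _ _ (hσ.lower_E s) (hτ.lower_E s),
        comm _ _ _ (hσ.lower_F s) (hτ.lower_F s)⟩
    | hm g h hg hh =>
      have : τ (g * h)⁻¹ * σ (g * h) = τ g⁻¹ * σ g * (τ h⁻¹ * σ h) := by
        rw [← mul_assoc, hC _ hg.1 hg.2, _root_.mul_inv_rev, map_mul, map_mul]
        simp only [mul_assoc]
      rw [this]
      constructor
      · rw [mul_assoc, hh.1, ← mul_assoc, hg.1, mul_assoc]
      · rw [mul_assoc, hh.2, ← mul_assoc, hg.2, mul_assoc]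
  refine ⟨{ toFun := fun g => τ g⁻¹ * σ g, map_one' := by simp, map_mul' := fun g h => ?_ },
    fun g => ?_, key⟩
  · rw [← mul_assoc, hC _ (key g).1 (key g).2, _root_.mul_inv_rev, map_mul, map_mul]
    simp only [mul_assoc]
  · change σ g = τ g * (τ g⁻¹ * σ g)
    rw [← mul_assoc, inv2, one_mul]

lemma char_eq_one (χ : SpecialLinearGroup (Fin 2) k → k) (h1 : χ 1 = 1)
    (hm : ∀ g h, χ (g * h) = χ g * χ h) (h2 : (2 : k) ≠ 0) (h3 : (3 : k) ≠ 0) (g) : χ g = 1 := by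
  have hinv : ∀ g, χ g * χ g⁻¹ = 1 := fun g => by rw [← hm, mul_inv_cancel, h1]
  have hu : ∀ s, χ (upperUni s) = 1 := by
    intro s
    have e1 : torus 2 h2 * upperUni (s / 3) = upperUni (s + s / 3) * torus 2 h2 := by
      apply Subtype.ext
      ext i j
      fin_cases i <;> fin_cases j <;> simp
      field_simp; ring
    have e2 := congrArg χ e1
    rw [upperUni_add, hm, hm, hm] at e2
    have ht := left_ne_zero_of_mul (hinv (torus 2 h2) ▸ one_ne_zero)
    have hs := left_ne_zero_of_mul (hinv (upperUni (s / 3)) ▸ one_ne_zero)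
    have : (χ (upperUni s) - 1) * (χ (upperUni (s / 3)) * χ (torus 2 h2)) = 0 := by
      linear_combination -e2
    exact sub_eq_zero.1 ((mul_eq_zero.1 this).resolve_right (mul_ne_zero hs ht))
  induction g using sl2_induction with
  | hu s => exact hu s
  | hl s =>
    have := weyl_conj_upperUni (-s)
    rw [neg_neg] at this
    rw [← this, hm, hm, hu, mul_one, hinv]
  | hm g h hg hh => rw [hm, hg, hh, one_mul]

end Conjugation

section NormalForms

variable {k : Type*} [Field k]

lemma commutator_pow_mul {R : Type*} [Ring R] [Algebra k R] {E F : R}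
    (hE : (E * F - F * E) * E - E * (E * F - F * E) = (2 : k) • E) (m : ℕ) :
    (E * F - F * E) * E ^ m = E ^ m * (E * F - F * E) + (2 * m : k) • E ^ m := by
  induction m with
  | zero => simp
  | succ m ih =>
    rw [pow_succ, ← mul_assoc, ih, add_mul, mul_assoc, sub_eq_iff_eq_add.1 hE, mul_add,
      smul_mul_assoc, mul_smul_comm, ← mul_assoc, Nat.cast_succ, mul_add, mul_one, add_smul]
    abel

lemma pow_succ_mul_lower {R : Type*} [Ring R] [Algebra k R] {E F : R}
    (hE : (E * F - F * E) * E - E * (E * F - F * E) = (2 : k) • E) (m : ℕ) :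
    E ^ (m + 1) * F = F * E ^ (m + 1) +
      (m + 1 : k) • (E ^ m * (E * F - F * E) + (m : k) • E ^ m) := by
  induction m with
  | zero => simp
  | succ m ih =>
    have h := commutator_pow_mul hE (m + 1)
    have h1 : E * F = F * E + (E * F - F * E) := by abel
    generalize E * F - F * E = H at *
    rw [pow_succ', mul_assoc, ih, mul_add, ← mul_assoc, h1, add_mul, mul_assoc, ← pow_succ',
      h, mul_smul_comm, mul_add, mul_smul_comm, ← mul_assoc, ← pow_succ']
    push_cast
    module

lemma commutator_mul_pow_eq {R : Type*} [Ring R] [Algebra k R] {E F : R}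
    (hE : (E * F - F * E) * E - E * (E * F - F * E) = (2 : k) • E) {m : ℕ}
    (hm : E ^ (m + 1) = 0) (hm' : (m + 1 : k) ≠ 0) :
    (E * F - F * E) * E ^ m = (m : k) • E ^ m := by
  have h1 := pow_succ_mul_lower hE m
  rw [hm, zero_mul, mul_zero, zero_add, eq_comm, smul_eq_zero] at h1
  rw [commutator_pow_mul hE, eq_neg_of_add_eq_zero_left (h1.resolve_left hm')]
  module

variable {V : Type*} [AddCommGroup V] [Module k V] {E F : Module.End k V}

lemma exists_highest_weight (hE : (E * F - F * E) * E - E * (E * F - F * E) = (2 : k) • E)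
    (hF : (E * F - F * E) * F - F * (E * F - F * E) = (-2 : k) • F) {m : ℕ} {w : V}
    (hm : E ^ (m + 1) = 0) (hm' : (m + 1 : k) ≠ 0) :
    E ((E ^ m) w) = 0 ∧ E (F ((E ^ m) w)) = (m : k) • (E ^ m) w ∧
      E (F (F ((E ^ m) w))) = (2 * m - 2 : k) • F ((E ^ m) w) ∧
      E (F (F (F ((E ^ m) w)))) = (3 * m - 6 : k) • F (F ((E ^ m) w)) := by
  have h0 : E ((E ^ m) w) = 0 := by
    rw [← Module.End.mul_apply, ← pow_succ', hm, LinearMap.zero_apply]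
  have h1 : E (F ((E ^ m) w)) = (m : k) • (E ^ m) w := by
    have := LinearMap.congr_fun (commutator_mul_pow_eq hE hm hm') w
    simpa [h0] using this
  have key : ∀ v, E (F (F v)) = (2 : k) • F (E (F v)) - F (F (E v)) - (2 : k) • F v := by
    intro v
    have := LinearMap.congr_fun hF v
    simp only [LinearMap.sub_apply, Module.End.mul_apply, LinearMap.smul_apply, map_sub] at this
    rw [sub_eq_iff_eq_add, sub_eq_iff_eq_add] at this
    rw [this]
    module
  have h2 : E (F (F ((E ^ m) w))) = (2 * m - 2 : k) • F ((E ^ m) w) := by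
    rw [key, h0, h1, map_smul, map_zero, map_zero]
    module
  refine ⟨h0, h1, h2, ?_⟩
  rw [key, h2, h1, map_smul, map_smul, map_smul]
  module

lemma normalForm_four (h2 : (2 : k) ≠ 0) (h3 : (3 : k) ≠ 0)
    (hE : (E * F - F * E) * E - E * (E * F - F * E) = (2 : k) • E)
    (hF : (E * F - F * E) * F - F * (E * F - F * E) = (-2 : k) • F)
    (hE4 : E ^ 4 = 0) (hF4 : F ^ 4 = 0) (hE3 : E ^ 3 ≠ 0) :
    ∃ b : Fin 4 → V, LinearIndependent k b ∧
      (∀ j, E (b j) = ∑ i, !![0, 1, 0, 0; 0, 0, 2, 0; 0, 0, 0, 3; 0, 0, 0, (0 : k)] i j • b i) ∧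
      ∀ j, F (b j) = ∑ i, !![0, 0, 0, 0; 3, 0, 0, 0; 0, 2, 0, 0; 0, 0, 1, (0 : k)] i j • b i := by
  obtain ⟨w, hw⟩ : ∃ w, (E ^ 3) w ≠ 0 := by
    by_contra! h
    exact hE3 (LinearMap.ext h)
  have h4 : (4 : k) ≠ 0 := by
    have : (4 : k) = 2 * 2 := by norm_num
    rw [this]
    exact mul_ne_zero h2 h2
  have h6 : (6 : k) ≠ 0 := by
    have : (6 : k) = 2 * 3 := by norm_num
    rw [this]
    exact mul_ne_zero h2 h3
  obtain ⟨e0, e1, e2, e3⟩ := exists_highest_weight (w := w) hE hF hE4 (by norm_num [h4])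
  have f4 : F (F (F (F ((E ^ 3) w)))) = 0 := LinearMap.congr_fun hF4 ((E ^ 3) w)
  generalize (E ^ 3) w = v at *
  push_cast at e1 e2 e3
  have e2' : E (F (F v)) = (4 : k) • F v := by rw [e2]; norm_num
  have e3' : E (F (F (F v))) = (3 : k) • F (F v) := by rw [e3]; norm_num
  refine ⟨![v, (3 : k)⁻¹ • F v, (6 : k)⁻¹ • F (F v), (6 : k)⁻¹ • F (F (F v))], ?_, ?_, ?_⟩
  · rw [Fintype.linearIndependent_iff]
    intro c hc
    simp only [Fin.sum_univ_four, cons_val] at hc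
    have k1 := congrArg E hc
    simp only [map_add, map_smul, map_zero, e0, e1, e2', e3'] at k1
    have k2 := congrArg E k1
    simp only [map_add, map_smul, map_zero, e0, e1, e2'] at k2
    have k3 := congrArg E k2
    simp only [map_add, map_smul, map_zero, e0, e1] at k3
    have c3 : c 3 = 0 := by simpa [smul_smul, hw, h2, h3, h6, h4] using k3
    have c2 : c 2 = 0 := by simpa [c3, smul_smul, hw, h2, h3, h6, h4] using k2
    have c1 : c 1 = 0 := by simpa [c2, c3, smul_smul, hw, h2, h3, h6, h4] using k1
    have c0 : c 0 = 0 := by simpa [c1, c2, c3, hw] using hc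
    intro i
    fin_cases i <;> assumption
  · have t1 : (6 : k)⁻¹ * 4 = 2 * 3⁻¹ := by field_simp; norm_num
    have t2 : (6 : k)⁻¹ * 3 = 3 * 6⁻¹ := by field_simp
    intro j
    fin_cases j <;> simp [Fin.sum_univ_four, e0, e1, e2', e3', smul_smul, h3, t1, t2]
  · have t1 : (2 : k) * 6⁻¹ = 3⁻¹ := by field_simp; norm_num
    intro j
    fin_cases j <;> simp [Fin.sum_univ_four, f4, smul_smul, h3, t1]

lemma exists_sum_four (hV : Module.finrank k V = 4) {x₀ x₁ x₂ x₃ : V}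
    (h : LinearIndependent k ![x₀, x₁, x₂, x₃]) (v : V) :
    ∃ c₀ c₁ c₂ c₃ : k, v = c₀ • x₀ + c₁ • x₁ + c₂ • x₂ + c₃ • x₃ := by
  let b := basisOfLinearIndependentOfCardEqFinrank h (by simp [hV])
  refine ⟨b.repr v 0, b.repr v 1, b.repr v 2, b.repr v 3, ?_⟩
  conv_lhs => rw [← b.sum_repr v]
  simp [Fin.sum_univ_four, b]

lemma linearIndependent_four_iff {x₀ x₁ x₂ x₃ : V} :
    LinearIndependent k ![x₀, x₁, x₂, x₃] ↔ ∀ c₀ c₁ c₂ c₃ : k,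
      c₀ • x₀ + c₁ • x₁ + c₂ • x₂ + c₃ • x₃ = 0 → c₀ = 0 ∧ c₁ = 0 ∧ c₂ = 0 ∧ c₃ = 0 := by
  rw [Fintype.linearIndependent_iff]
  constructor
  · intro h c₀ c₁ c₂ c₃ hc
    have := h ![c₀, c₁, c₂, c₃] (by simpa [Fin.sum_univ_four] using hc)
    exact ⟨this 0, this 1, this 2, this 3⟩
  · intro h c hc
    obtain ⟨h0, h1, h2, h3⟩ := h _ _ _ _ (by simpa [Fin.sum_univ_four] using hc)
    intro i
    fin_cases i <;> assumption

lemma normalForm_three (hV : Module.finrank k V = 4) (h2 : (2 : k) ≠ 0) (h3 : (3 : k) ≠ 0)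
    (hE : (E * F - F * E) * E - E * (E * F - F * E) = (2 : k) • E)
    (hF : (E * F - F * E) * F - F * (E * F - F * E) = (-2 : k) • F)
    (hE3 : E ^ 3 = 0) (hF3 : F ^ 3 = 0) (hE2 : E ^ 2 ≠ 0) :
    ∃ b : Fin 4 → V, LinearIndependent k b ∧
      (∀ j, E (b j) = ∑ i, !![0, 1, 0, 0; 0, 0, 2, 0; 0, 0, 0, 0; 0, 0, 0, (0 : k)] i j • b i) ∧
      ∀ j, F (b j) = ∑ i, !![0, 0, 0, 0; 2, 0, 0, 0; 0, 1, 0, 0; 0, 0, 0, (0 : k)] i j • b i := by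
  obtain ⟨w, hw⟩ : ∃ w, (E ^ 2) w ≠ 0 := by
    by_contra! h
    exact hE2 (LinearMap.ext h)
  have hE3' : ∀ x, E (E (E x)) = 0 := fun x => LinearMap.congr_fun hE3 x
  have hF3' : ∀ x, F (F (F x)) = 0 := fun x => LinearMap.congr_fun hF3 x
  obtain ⟨x₀, x₁, x₂, hx₀, E0, E1, E2, F0, F1, F2⟩ : ∃ x₀ x₁ x₂ : V, x₀ ≠ 0 ∧ E x₀ = 0 ∧
      E x₁ = x₀ ∧ E x₂ = (2 : k) • x₁ ∧ F x₀ = (2 : k) • x₁ ∧ F x₁ = x₂ ∧ F x₂ = 0 := by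
    obtain ⟨e0, e1, e2, -⟩ := exists_highest_weight (w := w) hE hF hE3 (by norm_num [h3])
    generalize (E ^ 2) w = v at *
    refine ⟨v, (2 : k)⁻¹ • F v, (2 : k)⁻¹ • F (F v), hw, e0, ?_, ?_, ?_, ?_, ?_⟩
    · simp [e1, smul_smul, h2]
    · rw [map_smul, e2]
      push_cast
      module
    · simp [smul_smul, h2]
    · simp
    · rw [map_smul, hF3', smul_zero]
  have hx : LinearIndependent k ![x₀, x₁, x₂] := by
    rw [Fintype.linearIndependent_iff]
    intro c hc
    simp only [Fin.sum_univ_three, cons_val] at hc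
    have k1 := congrArg E hc
    simp only [map_add, map_smul, map_zero, E0, E1, E2] at k1
    have k2 := congrArg E k1
    simp only [map_add, map_smul, map_zero, E0, E1] at k2
    have c2 : c 2 = 0 := by simpa [hx₀, h2] using k2
    have c1 : c 1 = 0 := by simpa [c2, hx₀] using k1
    have c0 : c 0 = 0 := by simpa [c1, c2, hx₀] using hc
    intro i
    fin_cases i <;> assumption
  obtain ⟨y, hy⟩ := exists_linearIndependent_cons_of_lt_finrank hx (by simp [hV])
  have hy : LinearIndependent k ![y, x₀, x₁, x₂] := hy
  obtain ⟨y', hy', hEy'⟩ : ∃ y', LinearIndependent k ![y', x₀, x₁, x₂] ∧ E y' = 0 := by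
    obtain ⟨α, a₀, a₁, a₂, ha⟩ := exists_sum_four hV hy (E y)
    rw [linearIndependent_four_iff] at hy
    have h := hE3' y
    simp only [ha, map_add, map_smul, E0, E1, E2, map_zero] at h
    obtain ⟨hα, hh, -⟩ := hy (α ^ 3) (α ^ 2 * a₀ + α * a₁ + 2 * a₂) (α ^ 2 * a₁ + 2 * α * a₂)
      (α ^ 2 * a₂) (by rw [← h]; module)
    obtain rfl : α = 0 := by simpa using hα
    obtain rfl : a₂ = 0 := by simpa [h2] using hh
    refine ⟨y - a₀ • x₁ - (a₁ * 2⁻¹) • x₂, ?_, ?_⟩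
    · rw [linearIndependent_four_iff]
      intro c₀ c₁ c₂ c₃ hc
      obtain ⟨rfl, rfl, q2, q3⟩ := hy c₀ c₁ (c₂ - c₀ * a₀) (c₃ - c₀ * (a₁ * 2⁻¹))
        (by rw [← hc]; module)
      exact ⟨rfl, rfl, by simpa using q2, by simpa using q3⟩
    · rw [map_sub, map_sub, map_smul, map_smul, ha, E1, E2, smul_smul, mul_assoc,
        inv_mul_cancel₀ h2]
      module
  obtain ⟨β, b₀, b₁, b₂, hb⟩ := exists_sum_four hV hy' (F y')
  rw [linearIndependent_four_iff] at hy'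
  have h := hF3' y'
  simp only [hb, map_add, map_smul, F0, F1, F2, map_zero] at h
  obtain ⟨hβ, -, -, hh⟩ := hy' (β ^ 3) (β ^ 2 * b₀) (β ^ 2 * b₁ + 2 * β * b₀)
    (β ^ 2 * b₂ + β * b₁ + 2 * b₀) (by rw [← h]; module)
  obtain rfl : β = 0 := by simpa using hβ
  obtain rfl : b₀ = 0 := by simpa [h2] using hh
  obtain rfl : b₂ = 0 := by
    have := LinearMap.congr_fun hE y'
    simpa [hEy', hb, E0, E1, E2, h2, hx₀] using this
  refine ⟨![x₀, x₁, x₂, y' - (b₁ * 2⁻¹) • x₀], ?_, ?_, ?_⟩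
  · rw [linearIndependent_four_iff]
    intro c₀ c₁ c₂ c₃ hc
    obtain ⟨rfl, q1, rfl, rfl⟩ := hy' c₃ (c₀ - c₃ * (b₁ * 2⁻¹)) c₁ c₂ (by rw [← hc]; module)
    simpa using q1
  · intro j
    fin_cases j <;> simp [Fin.sum_univ_four, E0, E1, E2, hEy']
  · intro j
    fin_cases j <;> simp [Fin.sum_univ_four, F0, F1, F2, hb, smul_smul, h2]

lemma lower_mul_cancel (h2 : (2 : k) ≠ 0)
    (hE : (E * F - F * E) * E - E * (E * F - F * E) = (2 : k) • E) (hE2 : E ^ 2 = 0) (v : V) :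
    E (F (E v)) = E v := by
  have hE2' : ∀ x, E (E x) = 0 := fun x => LinearMap.congr_fun hE2 x
  have := LinearMap.congr_fun hE v
  simp only [LinearMap.sub_apply, Module.End.mul_apply, LinearMap.smul_apply, map_sub, hE2',
    map_zero, sub_zero, zero_sub, sub_neg_eq_add, ← two_smul k (E (F (E v)))] at this
  exact smul_right_injective V h2 this

lemma linearIndependent_pair (h2 : (2 : k) ≠ 0)
    (hE : (E * F - F * E) * E - E * (E * F - F * E) = (2 : k) • E) (hE2 : E ^ 2 = 0)
    {w : V} (hw : E w ≠ 0) : LinearIndependent k ![E w, F (E w)] := by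
  have hE2' : E (E w) = 0 := LinearMap.congr_fun hE2 w
  rw [LinearIndependent.pair_iff]
  intro s t h
  have ht : t = 0 := by simpa [hE2', lower_mul_cancel h2 hE hE2, hw] using congrArg E h
  exact ⟨by simpa [ht, hw] using h, ht⟩

lemma normalForm_two (hV : Module.finrank k V = 4) (h2 : (2 : k) ≠ 0)
    (hE : (E * F - F * E) * E - E * (E * F - F * E) = (2 : k) • E)
    (hF : (E * F - F * E) * F - F * (E * F - F * E) = (-2 : k) • F)
    (hE2 : E ^ 2 = 0) (hF2 : F ^ 2 = 0) (hE0 : E ≠ 0) :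
    ∃ b : Fin 4 → V, LinearIndependent k b ∧
      (((∀ j, E (b j) = ∑ i, kron4 1 !![0, 1; 0, (0 : k)] i j • b i) ∧
        ∀ j, F (b j) = ∑ i, kron4 1 !![0, 0; 1, (0 : k)] i j • b i) ∨
      ((∀ j, E (b j) = ∑ i, blockDiag4 0 !![0, 1; 0, (0 : k)] i j • b i) ∧
        ∀ j, F (b j) = ∑ i, blockDiag4 0 !![0, 0; 1, (0 : k)] i j • b i)) := by
  have hE2' : ∀ x, E (E x) = 0 := fun x => LinearMap.congr_fun hE2 x
  have hF2' : ∀ x, F (F x) = 0 := fun x => LinearMap.congr_fun hF2 x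
  have hEF : ∀ x, E (F (E x)) = E x := lower_mul_cancel h2 hE hE2
  have hFE : ∀ x, F (E (F x)) = F x := by
    refine lower_mul_cancel h2 ?_ hF2
    rw [← neg_sub (E * F), neg_mul, mul_neg, sub_neg_eq_add, neg_add_eq_sub, ← neg_sub, hF]
    module
  by_cases hind : ∃ w w', LinearIndependent k ![E w, E w']
  · obtain ⟨w, w', hw⟩ := hind
    rw [LinearIndependent.pair_iff] at hw
    refine ⟨![E w, F (E w), E w', F (E w')], ?_, Or.inl ⟨?_, ?_⟩⟩
    · rw [linearIndependent_four_iff]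
      intro c₀ c₁ c₂ c₃ hc
      obtain ⟨rfl, rfl⟩ := hw c₁ c₃ (by simpa [hE2', hEF] using congrArg E hc)
      obtain ⟨rfl, rfl⟩ := hw c₀ c₂ (by simpa using hc)
      simp
    · intro j
      fin_cases j <;> simp [Fin.sum_univ_four, kron4, hE2', hEF]
    · intro j
      fin_cases j <;> simp [Fin.sum_univ_four, kron4, hF2']
  · obtain ⟨w, hw⟩ : ∃ w, E w ≠ 0 := by
      by_contra! h
      exact hE0 (LinearMap.ext h)
    have him : ∀ x, ∃ c : k, c • E w = E x := by
      intro x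
      by_contra! h
      exact hind ⟨w, x, (LinearIndependent.pair_iff' hw).2 h⟩
    obtain ⟨y, hy⟩ := exists_linearIndependent_cons_of_lt_finrank
      (linearIndependent_pair h2 hE hE2 hw) (by simp [hV])
    obtain ⟨y', hy'⟩ := exists_linearIndependent_cons_of_lt_finrank hy (by simp [hV])
    have hy' : LinearIndependent k ![y', y, E w, F (E w)] := hy'
    rw [linearIndependent_four_iff] at hy'
    obtain ⟨c, hc⟩ := him (F y)
    obtain ⟨d, hd⟩ := him y
    obtain ⟨c', hc'⟩ := him (F y')
    obtain ⟨d', hd'⟩ := him y'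
    refine ⟨![y' - E (F y') - F (E y'), y - E (F y) - F (E y), E w, F (E w)], ?_,
      Or.inr ⟨?_, ?_⟩⟩
    · rw [linearIndependent_four_iff]
      intro c₀ c₁ c₂ c₃ h
      rw [← hc, ← hd, ← hc', ← hd', map_smul, map_smul] at h
      obtain ⟨rfl, rfl, q2, q3⟩ := hy' c₀ c₁ (c₂ - c₀ * c' - c₁ * c) (c₃ - c₀ * d' - c₁ * d)
        (by rw [← h]; module)
      exact ⟨rfl, rfl, by simpa using q2, by simpa using q3⟩
    · intro j
      fin_cases j <;> simp [Fin.sum_univ_four, blockDiag4, hE2', hEF]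
    · intro j
      fin_cases j <;> simp [Fin.sum_univ_four, blockDiag4, hF2', hFE]

end NormalForms

section Reduction

variable {k : Type*} [Field k]

lemma exists_conj_of_linearIndependent {n : ℕ} {E F E₀ F₀ : Matrix (Fin n) (Fin n) k}
    {b : Fin n → Fin n → k} (hb : LinearIndependent k b)
    (hE : ∀ j, toLinAlgEquiv' E (b j) = ∑ i, E₀ i j • b i)
    (hF : ∀ j, toLinAlgEquiv' F (b j) = ∑ i, F₀ i j • b i) :
    ∃ P : GL (Fin n) k, E * P.1 = P.1 * E₀ ∧ F * P.1 = P.1 * F₀ := by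
  have hu : IsUnit (Matrix.of b)ᵀ := Matrix.linearIndependent_cols_iff_isUnit.1 hb
  have key : ∀ A A₀ : Matrix (Fin n) (Fin n) k, (∀ j, toLinAlgEquiv' A (b j) = ∑ i, A₀ i j • b i) →
      A * (Matrix.of b)ᵀ = (Matrix.of b)ᵀ * A₀ := by
    intro A A₀ h
    ext i j
    have := congrFun (h j) i
    simpa [Matrix.mul_apply, mulVec, dotProduct, mul_comm (b _ _), toLinAlgEquiv'_apply] using this
  obtain ⟨P, hP⟩ := hu
  exact ⟨P, hP ▸ key E E₀ hE, hP ▸ key F F₀ hF⟩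

section

variable {n : Type*} [Fintype n] [DecidableEq n]
  {σ : SpecialLinearGroup (Fin 2) k →* Matrix n n k} {U : Matrix n n k[X]}

lemma isInfinitesimal_conjRep [Infinite k] (hU : ∀ s, σ (upperUni s) = U.map (eval s))
    {P : GL n k} {E F : Matrix n n k} (hE : linCoeff U * P.1 = P.1 * E)
    (hF : lowerGen σ U * P.1 = P.1 * F) : IsInfinitesimal (conjRep P σ) E F := by
  have := (isInfinitesimal (conjRep_upperUni hU P)).1
  rwa [linCoeff_conj, lowerGen_conj, conj_eq_of_mul_eq hE, conj_eq_of_mul_eq hF] at this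

lemma lowerGen_pow_eq_zero {r : ℕ} (h : linCoeff U ^ r = 0) : lowerGen σ U ^ r = 0 := by
  have key : ∀ m, (σ (weyl k) * linCoeff U * σ (weyl k)⁻¹) ^ m =
      σ (weyl k) * linCoeff U ^ m * σ (weyl k)⁻¹ := by
    intro m
    induction m with
    | zero => rw [pow_zero, pow_zero, mul_one, map_weyl_mul_inv]
    | succ m ih =>
      calc _ = σ (weyl k) * linCoeff U ^ m * (σ (weyl k)⁻¹ * σ (weyl k)) * linCoeff U *
            σ (weyl k)⁻¹ := by rw [pow_succ, ih]; simp only [mul_assoc]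
        _ = _ := by rw [map_weyl_inv_mul, mul_one, pow_succ]; simp only [mul_assoc]
  rw [lowerGen, neg_pow, key, h, mul_zero, zero_mul, mul_zero]

lemma linCoeff_pow_card [Infinite k] (p : ℕ) [Fact p.Prime] [CharP k p]
    (hU : ∀ s, σ (upperUni s) = U.map (eval s)) : linCoeff U ^ Fintype.card n = 0 := by
  have := (Matrix.isNilpotent_charpoly_sub_pow_of_isNilpotent (isNilpotent_linCoeff p hU)).eq_zero
  have h2 := Matrix.aeval_self_charpoly (linCoeff U)
  rw [sub_eq_zero.1 this] at h2
  simpa using h2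

lemma eq_one_of_scalar (h2 : (2 : k) ≠ 0) (h3 : (3 : k) ≠ 0)
    {ρ : SpecialLinearGroup (Fin 2) k →* Matrix n n k} (i : n)
    (hm : ∀ g h, (ρ g * ρ h) i i = ρ g i i * ρ h i i) (g) : ρ g i i = 1 :=
  char_eq_one (fun g => ρ g i i) (by simp) (fun g h => by simp [hm]) h2 h3 g

end

lemma commutant_four (h2 : (2 : k) ≠ 0) (h3 : (3 : k) ≠ 0) {c : Matrix (Fin 4) (Fin 4) k}
    (hE : c * !![0, 1, 0, 0; 0, 0, 2, 0; 0, 0, 0, 3; 0, 0, 0, (0 : k)] =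
      !![0, 1, 0, 0; 0, 0, 2, 0; 0, 0, 0, 3; 0, 0, 0, (0 : k)] * c)
    (hF : c * !![0, 0, 0, 0; 3, 0, 0, 0; 0, 2, 0, 0; 0, 0, 1, (0 : k)] =
      !![0, 0, 0, 0; 3, 0, 0, 0; 0, 2, 0, 0; 0, 0, 1, (0 : k)] * c) : c = c 0 0 • 1 := by
  rw [← Matrix.ext_iff] at hE hF
  simp only [Fin.forall_fin_succ, Matrix.mul_apply, Fin.sum_univ_four] at hE hF
  simp at hE hF
  ext i j
  fin_cases i <;> fin_cases j <;> simp <;> grind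

/-- The relations of `sl(2)` among the infinitesimal generators, as endomorphisms. -/
lemma toLinAlgEquiv'_relations [Infinite k] {n : ℕ}
    {σ : SpecialLinearGroup (Fin 2) k →* Matrix (Fin n) (Fin n) k} {U : Matrix (Fin n) (Fin n) k[X]}
    (hU : ∀ s, σ (upperUni s) = U.map (eval s)) {E F : Module.End k (Fin n → k)}
    (hE : E = toLinAlgEquiv' (linCoeff U)) (hF : F = toLinAlgEquiv' (lowerGen σ U)) :
    (E * F - F * E) * E - E * (E * F - F * E) = (2 : k) • E ∧
      (E * F - F * E) * F - F * (E * F - F * E) = (-2 : k) • F := by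
  obtain ⟨-, h1, h2⟩ := isInfinitesimal hU
  have h1' := congrArg toLinAlgEquiv' h1
  have h2' := congrArg toLinAlgEquiv' h2
  simp only [map_sub, map_mul, map_smul, ← hE, ← hF] at h1' h2'
  exact ⟨h1', h2'⟩

end Reduction

section Commutants

variable {k : Type*} [Field k]

lemma commutant_three (h2 : (2 : k) ≠ 0) {c : Matrix (Fin 4) (Fin 4) k}
    (hE : c * !![0, 1, 0, 0; 0, 0, 2, 0; 0, 0, 0, 0; 0, 0, 0, (0 : k)] =
      !![0, 1, 0, 0; 0, 0, 2, 0; 0, 0, 0, 0; 0, 0, 0, (0 : k)] * c)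
    (hF : c * !![0, 0, 0, 0; 2, 0, 0, 0; 0, 1, 0, 0; 0, 0, 0, (0 : k)] =
      !![0, 0, 0, 0; 2, 0, 0, 0; 0, 1, 0, 0; 0, 0, 0, (0 : k)] * c) :
    c = diagonal ![c 0 0, c 0 0, c 0 0, c 3 3] := by
  rw [← Matrix.ext_iff] at hE hF
  simp only [Fin.forall_fin_succ, Matrix.mul_apply, Fin.sum_univ_four] at hE hF
  simp at hE hF
  ext i j
  fin_cases i <;> fin_cases j <;> simp [diagonal] <;> grind

lemma commutant_kron {c : Matrix (Fin 4) (Fin 4) k}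
    (hE : c * kron4 1 !![0, 1; 0, (0 : k)] = kron4 1 !![0, 1; 0, (0 : k)] * c)
    (hF : c * kron4 1 !![0, 0; 1, (0 : k)] = kron4 1 !![0, 0; 1, (0 : k)] * c) :
    c = kron4 (c.submatrix ![0, 2] ![0, 2]) 1 := by
  rw [← Matrix.ext_iff] at hE hF
  simp only [Fin.forall_fin_succ, Matrix.mul_apply, Fin.sum_univ_four, kron4] at hE hF
  simp at hE hF
  ext i j
  fin_cases i <;> fin_cases j <;> simp [kron4] <;> grind

lemma commutant_blockDiag {c : Matrix (Fin 4) (Fin 4) k}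
    (hE : c * blockDiag4 0 !![0, 1; 0, (0 : k)] = blockDiag4 0 !![0, 1; 0, (0 : k)] * c)
    (hF : c * blockDiag4 0 !![0, 0; 1, (0 : k)] = blockDiag4 0 !![0, 0; 1, (0 : k)] * c) :
    c = blockDiag4 (c.submatrix ![0, 1] ![0, 1]) (c 2 2 • 1) := by
  rw [← Matrix.ext_iff] at hE hF
  simp only [Fin.forall_fin_succ, Matrix.mul_apply, Fin.sum_univ_four, blockDiag4] at hE hF
  simp at hE hF
  ext i j
  fin_cases i <;> fin_cases j <;> simp [blockDiag4] <;> grind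

lemma commutant_two {c : Matrix (Fin 2) (Fin 2) k}
    (hE : c * !![0, 1; 0, (0 : k)] = !![0, 1; 0, (0 : k)] * c)
    (hF : c * !![0, 0; 1, (0 : k)] = !![0, 0; 1, (0 : k)] * c) : c = c 0 0 • 1 := by
  rw [← Matrix.ext_iff] at hE hF
  simp only [Fin.forall_fin_succ, Matrix.mul_apply, Fin.sum_univ_two] at hE hF
  simp at hE hF
  ext i j
  fin_cases i <;> fin_cases j <;> simp <;> grind

end Commutants

section ModelRepresentations

variable {k : Type*} [Field k]

lemma kron4_mul (X X' Y Y' : Matrix (Fin 2) (Fin 2) k) :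
    kron4 X Y * kron4 X' Y' = kron4 (X * X') (Y * Y') := by
  ext i j
  fin_cases i <;> fin_cases j <;>
    simp [kron4, Matrix.mul_apply, Fin.sum_univ_four, Fin.sum_univ_two] <;> ring

lemma blockDiag4_mul (X X' Y Y' : Matrix (Fin 2) (Fin 2) k) :
    blockDiag4 X Y * blockDiag4 X' Y' = blockDiag4 (X * X') (Y * Y') := by
  ext i j
  fin_cases i <;> fin_cases j <;>
    simp [blockDiag4, Matrix.mul_apply, Fin.sum_univ_four, Fin.sum_univ_two]

lemma kron4_one_one : kron4 (1 : Matrix (Fin 2) (Fin 2) k) 1 = 1 := by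
  ext i j
  fin_cases i <;> fin_cases j <;> simp [kron4]

lemma blockDiag4_one_one : blockDiag4 (1 : Matrix (Fin 2) (Fin 2) k) 1 = 1 := by
  ext i j
  fin_cases i <;> fin_cases j <;> simp [blockDiag4]

/-- The standard representation of `SL(2,k)`. -/
def stdRep (k : Type*) [Field k] : SpecialLinearGroup (Fin 2) k →* Matrix (Fin 2) (Fin 2) k where
  toFun g := g.1
  map_one' := rfl
  map_mul' _ _ := rfl

/-- Two copies of the standard representation of `SL(2,k)`. -/
noncomputable def kronRep (k : Type*) [Field k] :
    SpecialLinearGroup (Fin 2) k →* Matrix (Fin 4) (Fin 4) k where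
  toFun g := kron4 1 g.1
  map_one' := kron4_one_one
  map_mul' g h := by rw [kron4_mul, one_mul]; rfl

/-- The sum of two trivial representations and the standard representation of `SL(2,k)`. -/
noncomputable def blockDiagRep (k : Type*) [Field k] :
    SpecialLinearGroup (Fin 2) k →* Matrix (Fin 4) (Fin 4) k where
  toFun g := blockDiag4 1 g.1
  map_one' := blockDiag4_one_one
  map_mul' g h := by rw [blockDiag4_mul, one_mul]; rfl

/-- The third symmetric power of the standard representation of `SL(2,k)`. -/
noncomputable def cubicRep (k : Type*) [Field k] :
    SpecialLinearGroup (Fin 2) k →* Matrix (Fin 4) (Fin 4) k where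
  toFun := famI k 1
  map_one' := by
    ext i j
    fin_cases i <;> fin_cases j <;> simp [famI]
  map_mul' g h := by
    ext i j
    fin_cases i <;> fin_cases j <;>
      simp [famI, Matrix.mul_apply, Fin.sum_univ_four, Fin.sum_univ_two] <;> ring

/-- The sum of the second symmetric power of the standard representation of `SL(2,k)` and a
trivial representation. -/
noncomputable def quadraticRep (k : Type*) [Field k] :
    SpecialLinearGroup (Fin 2) k →* Matrix (Fin 4) (Fin 4) k where
  toFun := famIX k 1
  map_one' := by
    ext i j
    fin_cases i <;> fin_cases j <;> simp [famIX]
  map_mul' g h := by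
    ext i j
    fin_cases i <;> fin_cases j <;>
      simp [famIX, Matrix.mul_apply, Fin.sum_univ_four, Fin.sum_univ_two] <;> ring

lemma isInfinitesimal_stdRep :
    IsInfinitesimal (stdRep k) !![0, 1; 0, (0 : k)] !![0, 0; 1, (0 : k)] := by
  constructor <;> intro s <;> ext i j <;> fin_cases i <;> fin_cases j <;>
    simp [stdRep, Matrix.mul_apply, Fin.sum_univ_two] <;> ring

lemma kron4_one_add (Y Y' : Matrix (Fin 2) (Fin 2) k) :
    kron4 1 (Y + Y') = kron4 1 Y + kron4 1 Y' := by
  ext i j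
  fin_cases i <;> fin_cases j <;> simp [kron4]

lemma kron4_one_sub (Y Y' : Matrix (Fin 2) (Fin 2) k) :
    kron4 1 (Y - Y') = kron4 1 Y - kron4 1 Y' := by
  ext i j
  fin_cases i <;> fin_cases j <;> simp [kron4]

lemma kron4_one_smul (s : k) (Y : Matrix (Fin 2) (Fin 2) k) :
    kron4 1 (s • Y) = s • kron4 1 Y := by
  ext i j
  fin_cases i <;> fin_cases j <;> simp [kron4]

lemma blockDiag4_zero_add (Y Y' : Matrix (Fin 2) (Fin 2) k) :
    blockDiag4 0 (Y + Y') = blockDiag4 0 Y + blockDiag4 0 Y' := by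
  ext i j
  fin_cases i <;> fin_cases j <;> simp [blockDiag4]

lemma blockDiag4_zero_sub (Y Y' : Matrix (Fin 2) (Fin 2) k) :
    blockDiag4 0 (Y - Y') = blockDiag4 0 Y - blockDiag4 0 Y' := by
  ext i j
  fin_cases i <;> fin_cases j <;> simp [blockDiag4]

lemma blockDiag4_zero_smul (s : k) (Y : Matrix (Fin 2) (Fin 2) k) :
    blockDiag4 0 (s • Y) = s • blockDiag4 0 Y := by
  ext i j
  fin_cases i <;> fin_cases j <;> simp [blockDiag4]

lemma isInfinitesimal_kronRep :
    IsInfinitesimal (kronRep k) (kron4 1 !![0, 1; 0, (0 : k)]) (kron4 1 !![0, 0; 1, (0 : k)]) := by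
  have h := isInfinitesimal_stdRep (k := k)
  have hr : ∀ g, kronRep k g = kron4 1 (stdRep k g) := fun _ => rfl
  constructor <;> intro s <;>
    simp only [hr, kron4_mul, one_mul, ← kron4_one_add, ← kron4_one_sub, ← kron4_one_smul]
  · rw [h.upper_E]
  · rw [h.upper_F]
  · rw [h.lower_F]
  · rw [h.lower_E]

lemma isInfinitesimal_blockDiagRep :
    IsInfinitesimal (blockDiagRep k) (blockDiag4 0 !![0, 1; 0, (0 : k)])
      (blockDiag4 0 !![0, 0; 1, (0 : k)]) := by
  have h := isInfinitesimal_stdRep (k := k)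
  have hr : ∀ g, blockDiagRep k g = blockDiag4 1 (stdRep k g) := fun _ => rfl
  constructor <;> intro s <;>
    simp only [hr, blockDiag4_mul, mul_one, mul_zero, ← blockDiag4_zero_add,
      ← blockDiag4_zero_sub, ← blockDiag4_zero_smul]
  · rw [h.upper_E]
  · rw [h.upper_F]
  · rw [h.lower_F]
  · rw [h.lower_E]

lemma cubicRep_upperUni (s : k) : cubicRep k (upperUni s) =
    !![1, s, s ^ 2, s ^ 3; 0, 1, 2 * s, 3 * s ^ 2; 0, 0, 1, 3 * s; 0, 0, 0, 1] := by
  simp [cubicRep, famI, mul_comm]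

lemma cubicRep_lowerUni (s : k) : cubicRep k (lowerUni s) =
    !![1, 0, 0, 0; 3 * s, 1, 0, 0; 3 * s ^ 2, 2 * s, 1, 0; s ^ 3, s ^ 2, s, 1] := by
  simp [cubicRep, famI, mul_comm]

lemma isInfinitesimal_cubicRep :
    IsInfinitesimal (cubicRep k) !![0, 1, 0, 0; 0, 0, 2, 0; 0, 0, 0, 3; 0, 0, 0, (0 : k)]
      !![0, 0, 0, 0; 3, 0, 0, 0; 0, 2, 0, 0; 0, 0, 1, (0 : k)] := by
  constructor <;> intro s <;> simp only [cubicRep_upperUni, cubicRep_lowerUni] <;> ext i j <;>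
    simp only [Matrix.mul_apply, Fin.sum_univ_four, Matrix.add_apply, Matrix.sub_apply,
      Matrix.smul_apply] <;>
    fin_cases i <;> fin_cases j <;> simp <;> ring

lemma quadraticRep_upperUni (s : k) : quadraticRep k (upperUni s) =
    !![1, s, s ^ 2, 0; 0, 1, 2 * s, 0; 0, 0, 1, 0; 0, 0, 0, 1] := by
  simp [quadraticRep, famIX]

lemma quadraticRep_lowerUni (s : k) : quadraticRep k (lowerUni s) =
    !![1, 0, 0, 0; 2 * s, 1, 0, 0; s ^ 2, s, 1, 0; 0, 0, 0, 1] := by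
  simp [quadraticRep, famIX]

lemma isInfinitesimal_quadraticRep :
    IsInfinitesimal (quadraticRep k) !![0, 1, 0, 0; 0, 0, 2, 0; 0, 0, 0, 0; 0, 0, 0, (0 : k)]
      !![0, 0, 0, 0; 2, 0, 0, 0; 0, 1, 0, 0; 0, 0, 0, (0 : k)] := by
  constructor <;> intro s <;> simp only [quadraticRep_upperUni, quadraticRep_lowerUni] <;>
    ext i j <;>
    simp only [Matrix.mul_apply, Fin.sum_univ_four, Matrix.add_apply, Matrix.sub_apply,
      Matrix.smul_apply] <;>
    fin_cases i <;> fin_cases j <;> simp <;> ring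

end ModelRepresentations

lemma normalForm_std {k : Type*} [Field k] {V : Type*} [AddCommGroup V] [Module k V]
    {E F : Module.End k V} (h2 : (2 : k) ≠ 0)
    (hE : (E * F - F * E) * E - E * (E * F - F * E) = (2 : k) • E)
    (hE2 : E ^ 2 = 0) (hF2 : F ^ 2 = 0) (hE0 : E ≠ 0) :
    ∃ b : Fin 2 → V, LinearIndependent k b ∧
      (∀ j, E (b j) = ∑ i, !![0, 1; 0, (0 : k)] i j • b i) ∧
      ∀ j, F (b j) = ∑ i, !![0, 0; 1, (0 : k)] i j • b i := by
  obtain ⟨w, hw⟩ : ∃ w, E w ≠ 0 := by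
    by_contra! h
    exact hE0 (LinearMap.ext h)
  have e0 : E (E w) = 0 := LinearMap.congr_fun hE2 w
  have f1 : F (F (E w)) = 0 := LinearMap.congr_fun hF2 (E w)
  refine ⟨_, linearIndependent_pair h2 hE hE2 hw, fun j => ?_, fun j => ?_⟩
  · fin_cases j <;> simp [e0, lower_mul_cancel h2 hE hE2]
  · fin_cases j <;> simp [f1]

lemma eq_one_of_eq_smul_one {k : Type*} [Field k] {n : Type*} [Fintype n] [DecidableEq n]
    (h2 : (2 : k) ≠ 0) (h3 : (3 : k) ≠ 0) {ρ : SpecialLinearGroup (Fin 2) k →* Matrix n n k} (i : n)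
    (hρ : ∀ g, ρ g = ρ g i i • 1) (g) : ρ g = 1 := by
  rw [hρ g, eq_one_of_scalar h2 h3 i (fun g h => ?_) g, one_smul]
  rw [hρ g, hρ h]
  simp [mul_comm]

section TwoDimensional

variable {k : Type*} [Field k] (p : ℕ) [Fact p.Prime] [CharP k p]

lemma entryPow_frob (g : SpecialLinearGroup (Fin 2) k) (e : ℕ) :
    entryPow (frob p g).1 (p ^ e) = entryPow g.1 (p ^ (e + 1)) := by
  ext i j
  simp [entryPow, frob_apply, ← pow_mul, pow_succ']

theorem two_dimensional [IsAlgClosed k] (h2 : (2 : k) ≠ 0) (h3 : (3 : k) ≠ 0)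
    (σ : SpecialLinearGroup (Fin 2) k →* Matrix (Fin 2) (Fin 2) k) (U : Matrix (Fin 2) (Fin 2) k[X])
    (hU : ∀ s, σ (upperUni s) = U.map (eval s)) :
    (∀ g, σ g = 1) ∨ ∃ (e : ℕ) (Q : GL (Fin 2) k), ∀ g,
      σ g * Q.1 = Q.1 * entryPow g.1 (p ^ e) := by
  refine twist_induction p (motive := fun σ => (∀ g, σ g = 1) ∨ ∃ (e : ℕ) (Q : GL (Fin 2) k),
    ∀ g, σ g * Q.1 = Q.1 * entryPow g.1 (p ^ e)) (Or.inl fun _ => rfl) ?_ ?_ σ U hU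
  · intro σ σ' ih h
    rcases ih with ih | ⟨e, Q, ih⟩
    · exact Or.inl fun g => by rw [h, ih]
    · exact Or.inr ⟨e + 1, Q, fun g => by rw [h, ih, entryPow_frob]⟩
  · intro σ U hU hE0
    right
    obtain ⟨hE, -⟩ := toLinAlgEquiv'_relations hU rfl rfl
    have hE2 : linCoeff U ^ 2 = 0 := linCoeff_pow_card p hU
    obtain ⟨b, hb, hbE, hbF⟩ := normalForm_std h2 hE (by rw [← map_pow, hE2, map_zero])
      (by rw [← map_pow, lowerGen_pow_eq_zero hE2, map_zero])
      ((map_ne_zero_iff _ toLinAlgEquiv'.injective).2 hE0)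
    obtain ⟨P, hP1, hP2⟩ := exists_conj_of_linearIndependent hb hbE hbF
    obtain ⟨ρ, hρ, hcomm⟩ := exists_factor (isInfinitesimal_conjRep hU hP1 hP2)
      isInfinitesimal_stdRep (fun c h1 h2 g => by
        rw [commutant_two h1 h2, smul_mul_assoc, mul_smul_comm, one_mul, mul_one])
    have hsc : ∀ g, ρ g = ρ g 0 0 • 1 := fun g => commutant_two (hcomm g).1 (hcomm g).2
    have hρ1 := eq_one_of_eq_smul_one h2 h3 0 hsc
    refine ⟨0, P, fun g => ?_⟩
    have h := hρ g
    rw [hρ1, mul_one, conjRep_apply] at h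
    have h' : entryPow g.1 (p ^ 0) = stdRep k g := by
      ext i j
      simp [entryPow, stdRep]
    have hPP : P.1 * (P⁻¹).1 = 1 := Units.mul_inv P
    rw [h', ← h, ← mul_assoc, ← mul_assoc, hPP, one_mul]

end TwoDimensional

section Equivalence

variable {k : Type*} [Field k]

lemma MatEquiv.of_mul_eq {f g : SpecialLinearGroup (Fin 2) k → Matrix (Fin 4) (Fin 4) k}
    (P : GL (Fin 4) k) (h : ∀ A, f A * P.1 = P.1 * g A) : MatEquiv f g :=
  ⟨P, fun A => conj_eq_of_mul_eq (h A)⟩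

lemma MatEquiv.mul_eq {f g : SpecialLinearGroup (Fin 2) k → Matrix (Fin 4) (Fin 4) k}
    (h : MatEquiv f g) : ∃ P : GL (Fin 4) k, ∀ A, f A * P.1 = P.1 * g A := by
  obtain ⟨P, hP⟩ := h
  refine ⟨P, fun A => ?_⟩
  have hPP : P.1 * (P⁻¹).1 = 1 := Units.mul_inv P
  rw [← hP A, ← mul_assoc, ← mul_assoc, hPP, one_mul]

lemma MatEquiv.refl (f : SpecialLinearGroup (Fin 2) k → Matrix (Fin 4) (Fin 4) k) :
    MatEquiv f f := .of_mul_eq 1 fun A => by simp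

lemma MatEquiv.symm {f g : SpecialLinearGroup (Fin 2) k → Matrix (Fin 4) (Fin 4) k}
    (h : MatEquiv f g) : MatEquiv g f := by
  obtain ⟨P, hP⟩ := h
  refine .of_mul_eq P⁻¹ fun A => ?_
  have hPP : P.1 * (P⁻¹).1 = 1 := Units.mul_inv P
  rw [← hP A, mul_assoc, hPP, mul_one]

lemma MatEquiv.trans {f g h : SpecialLinearGroup (Fin 2) k → Matrix (Fin 4) (Fin 4) k}
    (hfg : MatEquiv f g) (hgh : MatEquiv g h) : MatEquiv f h := by
  obtain ⟨P, hP⟩ := hfg.mul_eq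
  obtain ⟨Q, hQ⟩ := hgh.mul_eq
  refine .of_mul_eq (P * Q) fun A => ?_
  rw [Units.val_mul, ← mul_assoc, hP, mul_assoc, hQ, mul_assoc]

lemma matEquiv_conjRep (P : GL (Fin 4) k)
    (σ : SpecialLinearGroup (Fin 2) k →* Matrix (Fin 4) (Fin 4) k) : MatEquiv σ (conjRep P σ) :=
  ⟨P, fun _ => rfl⟩

lemma exists_kron4_mul_eq (Q : GL (Fin 2) k) : ∃ P : GL (Fin 4) k, P.1 = kron4 Q.1 1 := by
  have h1 : Q.1 * (Q⁻¹).1 = 1 := Units.mul_inv Q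
  have h2 : (Q⁻¹).1 * Q.1 = 1 := Units.inv_mul Q
  exact ⟨⟨kron4 Q.1 1, kron4 (Q⁻¹).1 1, by rw [kron4_mul, h1, one_mul, kron4_one_one],
    by rw [kron4_mul, h2, one_mul, kron4_one_one]⟩, rfl⟩

lemma exists_blockDiag4_mul_eq (Q : GL (Fin 2) k) :
    ∃ P : GL (Fin 4) k, P.1 = blockDiag4 Q.1 1 := by
  have h1 : Q.1 * (Q⁻¹).1 = 1 := Units.mul_inv Q
  have h2 : (Q⁻¹).1 * Q.1 = 1 := Units.inv_mul Q
  exact ⟨⟨blockDiag4 Q.1 1, blockDiag4 (Q⁻¹).1 1,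
    by rw [blockDiag4_mul, h1, one_mul, blockDiag4_one_one],
    by rw [blockDiag4_mul, h2, one_mul, blockDiag4_one_one]⟩, rfl⟩

lemma matEquiv_blockDiag4_swap (X Y : SpecialLinearGroup (Fin 2) k → Matrix (Fin 2) (Fin 2) k) :
    MatEquiv (fun A => blockDiag4 (X A) (Y A)) (fun A => blockDiag4 (Y A) (X A)) := by
  have h : !![0, 0, 1, 0; 0, 0, 0, 1; 1, 0, 0, 0; 0, 1, 0, (0 : k)] *
      !![0, 0, 1, 0; 0, 0, 0, 1; 1, 0, 0, 0; 0, 1, 0, (0 : k)] = 1 := by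
    ext i j
    fin_cases i <;> fin_cases j <;> simp [Matrix.mul_apply, Fin.sum_univ_four]
  refine .of_mul_eq ⟨_, _, h, h⟩ fun A => ?_
  ext i j
  fin_cases i <;> fin_cases j <;> simp [blockDiag4, Matrix.mul_apply, Fin.sum_univ_four]

end Equivalence

section FourDimensional

variable {k : Type*} [Field k]

lemma eq_famI (h2 : (2 : k) ≠ 0) (h3 : (3 : k) ≠ 0)
    {σ : SpecialLinearGroup (Fin 2) k →* Matrix (Fin 4) (Fin 4) k}
    (h : IsInfinitesimal σ !![0, 1, 0, 0; 0, 0, 2, 0; 0, 0, 0, 3; 0, 0, 0, (0 : k)]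
      !![0, 0, 0, 0; 3, 0, 0, 0; 0, 2, 0, 0; 0, 0, 1, (0 : k)]) (g) : σ g = famI k 1 g := by
  obtain ⟨ρ, hρ, hcomm⟩ := exists_factor h isInfinitesimal_cubicRep (fun c hE hF g => by
    rw [commutant_four h2 h3 hE hF, smul_mul_assoc, mul_smul_comm, one_mul, mul_one])
  rw [hρ, eq_one_of_eq_smul_one h2 h3 0
    (fun g => commutant_four h2 h3 (hcomm g).1 (hcomm g).2), mul_one]
  rfl

lemma eq_famIX (h2 : (2 : k) ≠ 0) (h3 : (3 : k) ≠ 0)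
    {σ : SpecialLinearGroup (Fin 2) k →* Matrix (Fin 4) (Fin 4) k}
    (h : IsInfinitesimal σ !![0, 1, 0, 0; 0, 0, 2, 0; 0, 0, 0, 0; 0, 0, 0, (0 : k)]
      !![0, 0, 0, 0; 2, 0, 0, 0; 0, 1, 0, 0; 0, 0, 0, (0 : k)]) (g) : σ g = famIX k 1 g := by
  obtain ⟨ρ, hρ, hcomm⟩ := exists_factor h isInfinitesimal_quadraticRep (fun c hE hF g => by
    rw [commutant_three h2 hE hF]
    ext i j
    rw [diagonal_mul, mul_diagonal]
    fin_cases i <;> fin_cases j <;> simp [quadraticRep, famIX, mul_comm])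
  have hdiag : ∀ g, ρ g = diagonal ![ρ g 0 0, ρ g 0 0, ρ g 0 0, ρ g 3 3] := fun g =>
    commutant_three h2 (hcomm g).1 (hcomm g).2
  have hm : ∀ (i : Fin 4) g h, (ρ g * ρ h) i i = ρ g i i * ρ h i i := by
    intro i g h
    rw [hdiag g, hdiag h, diagonal_mul_diagonal]
    simp
  have hρ1 : ρ g = 1 := by
    rw [hdiag g, eq_one_of_scalar h2 h3 0 (hm 0), eq_one_of_scalar h2 h3 3 (hm 3)]
    ext i j
    fin_cases i <;> fin_cases j <;> simp [diagonal]
  rw [hρ, hρ1, mul_one]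
  rfl

lemma submatrix_kron4 (X Y : Matrix (Fin 2) (Fin 2) k) :
    (kron4 X Y).submatrix ![0, 2] ![0, 2] = Y 0 0 • X := by
  ext i j
  fin_cases i <;> fin_cases j <;> simp [kron4, mul_comm]

lemma submatrix_blockDiag4 (X Y : Matrix (Fin 2) (Fin 2) k) :
    (blockDiag4 X Y).submatrix ![0, 1] ![0, 1] = X := by
  ext i j
  fin_cases i <;> fin_cases j <;> simp [blockDiag4]

variable [IsAlgClosed k] (p : ℕ) [Fact p.Prime] [CharP k p]

lemma exists_list13_of_kron (h2 : (2 : k) ≠ 0) (h3 : (3 : k) ≠ 0)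
    {σ : SpecialLinearGroup (Fin 2) k →* Matrix (Fin 4) (Fin 4) k} {U : Matrix (Fin 4) (Fin 4) k[X]}
    (hU : ∀ s, σ (upperUni s) = U.map (eval s)) (hE : linCoeff U = kron4 1 !![0, 1; 0, (0 : k)])
    (h : IsInfinitesimal σ (kron4 1 !![0, 1; 0, (0 : k)]) (kron4 1 !![0, 0; 1, (0 : k)])) :
    ∃ i, MatEquiv σ (list13 p i) := by
  obtain ⟨ρ, hρ, hcomm⟩ := exists_factor h isInfinitesimal_kronRep (fun c hE hF g => by
    rw [commutant_kron hE hF]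
    change kron4 _ 1 * kron4 1 g.1 = kron4 1 g.1 * kron4 _ 1
    rw [kron4_mul, kron4_mul, one_mul, mul_one, mul_one, one_mul])
  have hk : ∀ g, ρ g = kron4 ((ρ g).submatrix ![0, 2] ![0, 2]) 1 := fun g =>
    commutant_kron (hcomm g).1 (hcomm g).2
  obtain ⟨X, hX⟩ : ∃ X : SpecialLinearGroup (Fin 2) k →* Matrix (Fin 2) (Fin 2) k,
      ∀ g, X g = (ρ g).submatrix ![0, 2] ![0, 2] := by
    refine ⟨⟨⟨fun g => (ρ g).submatrix ![0, 2] ![0, 2], ?_⟩, fun g g' => ?_⟩, fun _ => rfl⟩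
    · rw [map_one, ← kron4_one_one, submatrix_kron4, one_apply_eq, one_smul]
    · change (ρ (g * g')).submatrix ![0, 2] ![0, 2] =
        (ρ g).submatrix ![0, 2] ![0, 2] * (ρ g').submatrix ![0, 2] ![0, 2]
      conv_lhs => rw [map_mul, hk g, hk g', kron4_mul, submatrix_kron4]
      simp
  simp only [← hX] at hk
  have hσ : ∀ g, σ g = kron4 (X g) g.1 := by
    intro g
    rw [hρ, hk]
    change kron4 1 g.1 * kron4 _ 1 = _
    rw [kron4_mul, one_mul, mul_one]
  have hUX : ∀ s, X (upperUni s) = (U.submatrix ![0, 2] ![0, 2]).map (eval s) := by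
    intro s
    rw [← submatrix_map, ← hU, hσ, submatrix_kron4]
    simp
  have hE' : linCoeff (U.submatrix ![0, 2] ![0, 2]) = 0 := by
    rw [linCoeff, ← submatrix_map]
    change (linCoeff U).submatrix _ _ = 0
    rw [hE, submatrix_kron4]
    simp
  obtain ⟨X', U', hU', -, hX'⟩ := exists_untwist p hUX hE'
  rcases two_dimensional p h2 h3 X' U' hU' with h1 | ⟨e, Q, hQ⟩
  · refine ⟨.XV 0 0 le_rfl, ?_⟩
    convert MatEquiv.refl _ using 1
    ext1 A
    rw [hσ, hX', h1]
    ext i j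
    fin_cases i <;> fin_cases j <;> simp [list13, kron4, blockDiag4, entryPow]
  · obtain ⟨P, hP⟩ := exists_kron4_mul_eq Q
    refine ⟨.IV 0 (e + 1) (Nat.succ_pos e), .of_mul_eq P fun A => ?_⟩
    have h0 : entryPow A.1 (p ^ 0) = A.1 := by
      ext i j
      simp [entryPow]
    rw [hσ, hX', hP, kron4_mul, hQ, entryPow_frob, list13, kron4_mul, h0, one_mul, mul_one]

lemma exists_list13_of_blockDiag (h2 : (2 : k) ≠ 0) (h3 : (3 : k) ≠ 0)
    {σ : SpecialLinearGroup (Fin 2) k →* Matrix (Fin 4) (Fin 4) k} {U : Matrix (Fin 4) (Fin 4) k[X]}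
    (hU : ∀ s, σ (upperUni s) = U.map (eval s))
    (h : IsInfinitesimal σ (blockDiag4 0 !![0, 1; 0, (0 : k)])
      (blockDiag4 0 !![0, 0; 1, (0 : k)])) :
    ∃ i, MatEquiv σ (list13 p i) := by
  obtain ⟨ρ, hρ, hcomm⟩ := exists_factor h isInfinitesimal_blockDiagRep (fun c hE hF g => by
    rw [commutant_blockDiag hE hF]
    change blockDiag4 _ _ * blockDiag4 1 g.1 = blockDiag4 1 g.1 * blockDiag4 _ _
    rw [blockDiag4_mul, blockDiag4_mul, one_mul, mul_one, smul_mul_assoc, mul_smul_comm,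
      mul_one, one_mul])
  have hk : ∀ g, ρ g = blockDiag4 ((ρ g).submatrix ![0, 1] ![0, 1]) (ρ g 2 2 • 1) := fun g =>
    commutant_blockDiag (hcomm g).1 (hcomm g).2
  have hc : ∀ g, ρ g 2 2 = 1 := eq_one_of_scalar h2 h3 2 (fun g g' => by
    rw [hk g, hk g', blockDiag4_mul]
    simp [blockDiag4, mul_comm])
  simp only [hc, one_smul] at hk
  obtain ⟨X, hX⟩ : ∃ X : SpecialLinearGroup (Fin 2) k →* Matrix (Fin 2) (Fin 2) k,
      ∀ g, X g = (ρ g).submatrix ![0, 1] ![0, 1] := by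
    refine ⟨⟨⟨fun g => (ρ g).submatrix ![0, 1] ![0, 1], ?_⟩, fun g g' => ?_⟩, fun _ => rfl⟩
    · rw [map_one, ← blockDiag4_one_one, submatrix_blockDiag4]
    · change (ρ (g * g')).submatrix ![0, 1] ![0, 1] =
        (ρ g).submatrix ![0, 1] ![0, 1] * (ρ g').submatrix ![0, 1] ![0, 1]
      conv_lhs => rw [map_mul, hk g, hk g', blockDiag4_mul, submatrix_blockDiag4]
  simp only [← hX] at hk
  have hσ : ∀ g, σ g = blockDiag4 (X g) g.1 := by
    intro g
    rw [hρ, hk]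
    change blockDiag4 1 g.1 * blockDiag4 _ 1 = _
    rw [blockDiag4_mul, one_mul, mul_one]
  have hUX : ∀ s, X (upperUni s) = (U.submatrix ![0, 1] ![0, 1]).map (eval s) := by
    intro s
    rw [← submatrix_map, ← hU, hσ, submatrix_blockDiag4]
  have h0 : ∀ A : SpecialLinearGroup (Fin 2) k, entryPow A.1 (p ^ 0) = A.1 := by
    intro A
    ext i j
    simp [entryPow]
  rcases two_dimensional p h2 h3 X _ hUX with h1 | ⟨e, Q, hQ⟩
  · refine ⟨.XXIV 0, ?_⟩
    convert matEquiv_blockDiag4_swap (fun _ => 1) (fun A => A.1) using 1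
    · ext1 A
      rw [hσ, h1]
    · ext1 A
      exact congrArg (blockDiag4 · 1) (h0 A)
  · obtain ⟨P, hP⟩ := exists_blockDiag4_mul_eq Q
    refine ⟨.XV e 0 (Nat.zero_le e), .of_mul_eq P fun A => ?_⟩
    rw [hσ, hP, blockDiag4_mul, hQ, list13, blockDiag4_mul, h0, one_mul, mul_one]

end FourDimensional

section Classification

variable {k : Type*} [Field k] (p : ℕ) [Fact p.Prime] [CharP k p]

lemma famI_frob (g : SpecialLinearGroup (Fin 2) k) (q : ℕ) :
    famI k q (frob p g) = famI k (p * q) g := by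
  have h : ∀ m, p * (m * q) = m * (p * q) := fun m => by ring
  simp only [famI, frob_apply, ← pow_mul, h]

lemma famIX_frob (g : SpecialLinearGroup (Fin 2) k) (q : ℕ) :
    famIX k q (frob p g) = famIX k (p * q) g := by
  have h : ∀ m, p * (m * q) = m * (p * q) := fun m => by ring
  simp only [famIX, frob_apply, ← pow_mul, h]

lemma exists_list13_frob (i : Idx13) :
    ∃ j, ∀ g : SpecialLinearGroup (Fin 2) k, list13 p i (frob p g) = list13 p j g := by
  cases i with
  | I e => exact ⟨.I (e + 1), fun g => by simp only [list13, famI_frob, pow_succ']⟩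
  | IV e₁ e₂ h =>
    exact ⟨.IV (e₁ + 1) (e₂ + 1) (Nat.succ_lt_succ h), fun g => by
      simp only [list13, entryPow_frob]⟩
  | IX e => exact ⟨.IX (e + 1), fun g => by simp only [list13, famIX_frob, pow_succ']⟩
  | XV e₂ e₃ h =>
    exact ⟨.XV (e₂ + 1) (e₃ + 1) (Nat.succ_le_succ h), fun g => by
      simp only [list13, entryPow_frob]⟩
  | XXIV e => exact ⟨.XXIV (e + 1), fun g => by simp only [list13, entryPow_frob]⟩
  | XXVI => exact ⟨.XXVI, fun _ => rfl⟩

theorem four_dimensional [IsAlgClosed k] (h2 : (2 : k) ≠ 0) (h3 : (3 : k) ≠ 0)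
    (σ : SpecialLinearGroup (Fin 2) k →* Matrix (Fin 4) (Fin 4) k) (U : Matrix (Fin 4) (Fin 4) k[X])
    (hU : ∀ s, σ (upperUni s) = U.map (eval s)) : ∃ i, MatEquiv σ (list13 p i) := by
  refine twist_induction p (motive := fun σ => ∃ i, MatEquiv σ (list13 p i))
    ⟨.XXVI, .refl _⟩ ?_ ?_ σ U hU
  · rintro σ σ' ⟨i, P, hP⟩ h
    obtain ⟨j, hj⟩ := exists_list13_frob (k := k) p i
    exact ⟨j, P, fun g => by rw [h, hP, hj]⟩
  · intro σ U hU hE0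
    have hV : Module.finrank k (Fin 4 → k) = 4 := by simp
    have hne : ∀ {A : Matrix (Fin 4) (Fin 4) k}, A ≠ 0 → toLinAlgEquiv' A ≠ 0 :=
      (map_ne_zero_iff _ toLinAlgEquiv'.injective).2
    obtain ⟨hE, hF⟩ := toLinAlgEquiv'_relations hU rfl rfl
    have hpow : ∀ r, linCoeff U ^ r = 0 → toLinAlgEquiv' (linCoeff U) ^ r = 0 ∧
        toLinAlgEquiv' (lowerGen σ U) ^ r = 0 := fun r h =>
      ⟨by rw [← map_pow, h, map_zero], by rw [← map_pow, lowerGen_pow_eq_zero h, map_zero]⟩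
    by_cases hE3 : linCoeff U ^ 3 = 0
    · by_cases hE2 : linCoeff U ^ 2 = 0
      · obtain ⟨b, hb, ⟨hbE, hbF⟩ | ⟨hbE, hbF⟩⟩ := normalForm_two hV h2 hE hF (hpow 2 hE2).1
          (hpow 2 hE2).2 (hne hE0)
        · obtain ⟨P, hP1, hP2⟩ := exists_conj_of_linearIndependent hb hbE hbF
          obtain ⟨i, hi⟩ := exists_list13_of_kron p h2 h3 (conjRep_upperUni hU P)
            ((linCoeff_conj U P).trans (conj_eq_of_mul_eq hP1)) (isInfinitesimal_conjRep hU hP1 hP2)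
          exact ⟨i, (matEquiv_conjRep P σ).trans hi⟩
        · obtain ⟨P, hP1, hP2⟩ := exists_conj_of_linearIndependent hb hbE hbF
          obtain ⟨i, hi⟩ := exists_list13_of_blockDiag p h2 h3 (conjRep_upperUni hU P)
            (isInfinitesimal_conjRep hU hP1 hP2)
          exact ⟨i, (matEquiv_conjRep P σ).trans hi⟩
      · obtain ⟨b, hb, hbE, hbF⟩ := normalForm_three hV h2 h3 hE hF (hpow 3 hE3).1 (hpow 3 hE3).2
          (by rw [← map_pow]; exact hne hE2)
        obtain ⟨P, hP1, hP2⟩ := exists_conj_of_linearIndependent hb hbE hbF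
        refine ⟨.IX 0, P, fun g => ?_⟩
        rw [list13, pow_zero]
        exact eq_famIX h2 h3 (isInfinitesimal_conjRep hU hP1 hP2) g
    · have hE4 : linCoeff U ^ 4 = 0 := linCoeff_pow_card p hU
      obtain ⟨b, hb, hbE, hbF⟩ := normalForm_four h2 h3 hE hF (hpow 4 hE4).1 (hpow 4 hE4).2
        (by rw [← map_pow]; exact hne hE3)
      obtain ⟨P, hP1, hP2⟩ := exists_conj_of_linearIndependent hb hbE hbF
      refine ⟨.I 0, P, fun g => ?_⟩
      rw [list13, pow_zero]
      exact eq_famI h2 h3 (isInfinitesimal_conjRep hU hP1 hP2) g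

end Classification

lemma IsPolyEntries.exists_upperUni {k : Type*} [Field k]
    {σ : SpecialLinearGroup (Fin 2) k → Matrix (Fin 4) (Fin 4) k} (h : IsPolyEntries σ) :
    ∃ U : Matrix (Fin 4) (Fin 4) k[X], ∀ s, σ (upperUni s) = U.map (eval s) := by
  choose P hP using h
  refine ⟨.of fun i j => MvPolynomial.aeval
    (fun x : Fin 2 × Fin 2 => !![1, X; 0, (1 : k[X])] x.1 x.2) (P i j), fun s => ?_⟩
  ext i j
  rw [hP, map_apply, of_apply, ← coe_evalRingHom, MvPolynomial.aeval_def,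
    MvPolynomial.hom_eval₂, MvPolynomial.eval, MvPolynomial.coe_eval₂Hom]
  congr 1
  · ext x
    simp
  · ext ⟨i, j⟩
    fin_cases i <;> fin_cases j <;> simp

section Uniqueness

lemma MatEquiv.trace_eq {k : Type*} [Field k]
    {f g : SpecialLinearGroup (Fin 2) k → Matrix (Fin 4) (Fin 4) k} (h : MatEquiv f g) (A) :
    (f A).trace = (g A).trace := by
  obtain ⟨P, hP⟩ := h
  have hPP : P.1 * (P⁻¹).1 = 1 := Units.mul_inv P
  rw [← hP A, trace_mul_comm, ← mul_assoc, hPP, one_mul]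

/-- The two nonnegative weights of a member of the list. -/
def Idx13.weight (p : ℕ) : Idx13 → ℕ × ℕ
  | .I e => (3 * p ^ e, p ^ e)
  | .IV e₁ e₂ _ => (p ^ e₂ + p ^ e₁, p ^ e₂ - p ^ e₁)
  | .IX e => (2 * p ^ e, 0)
  | .XV e₂ e₃ _ => (p ^ e₂, p ^ e₃)
  | .XXIV e => (p ^ e, 0)
  | .XXVI => (0, 0)

lemma trace_list13_torus {k : Type*} [Field k] {p : ℕ} (hp : 0 < p) (i : Idx13) (t : k)
    (ht : t ≠ 0) : (list13 p i (torus t ht)).trace = t ^ (i.weight p).1 + t⁻¹ ^ (i.weight p).1 +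
      t ^ (i.weight p).2 + t⁻¹ ^ (i.weight p).2 := by
  have h0 : ∀ e, (0 : k) ^ p ^ e = 0 := fun e => zero_pow (pow_pos hp e).ne'
  have hc : ∀ m, t ^ m * (t ^ m)⁻¹ = 1 := fun m => mul_inv_cancel₀ (pow_ne_zero m ht)
  cases i with
  | I e =>
    simp [list13, famI, Idx13.weight, trace, Fin.sum_univ_four, h0, hc]
    ring
  | IV e₁ e₂ h =>
    obtain ⟨d, hd⟩ := Nat.exists_eq_add_of_le (Nat.pow_le_pow_right hp h.le)
    simp [list13, kron4, entryPow, Idx13.weight, trace, Fin.sum_univ_four, hd, pow_add]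
    field_simp
    ring
  | IX e =>
    simp [list13, famIX, Idx13.weight, trace, Fin.sum_univ_four, h0, hc]
    ring
  | XV e₂ e₃ h =>
    simp [list13, blockDiag4, entryPow, Idx13.weight, trace, Fin.sum_univ_four, add_assoc]
  | XXIV e =>
    simp [list13, blockDiag4, entryPow, Idx13.weight, trace, Fin.sum_univ_four]
  | XXVI =>
    simp [list13, Idx13.weight]
    norm_num

lemma weight_snd_le_fst {p : ℕ} (hp : 0 < p) (i : Idx13) : (i.weight p).2 ≤ (i.weight p).1 := by
  cases i with
  | XV e₂ e₃ h => exact Nat.pow_le_pow_right hp h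
  | _ => simp only [Idx13.weight]; omega

lemma weights_eq_of_trace_eq {k : Type*} [Field k] [Infinite k] (h2 : (2 : k) ≠ 0)
    {m n m' n' : ℕ} (hmn : n ≤ m) (hmn' : n' ≤ m')
    (h : ∀ t : k, t ≠ 0 → t ^ m + t⁻¹ ^ m + t ^ n + t⁻¹ ^ n =
      t ^ m' + t⁻¹ ^ m' + t ^ n' + t⁻¹ ^ n') : m = m' ∧ n = n' := by
  obtain ⟨N, hN⟩ : ∃ N, N = m + m' := ⟨_, rfl⟩
  have key : (X ^ (N + m) + X ^ (N - m) + X ^ (N + n) + X ^ (N - n) : k[X]) =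
      X ^ (N + m') + X ^ (N - m') + X ^ (N + n') + X ^ (N - n') := by
    have hs : ∀ (t : k) (r : ℕ), t ≠ 0 → r ≤ N → t ^ (N - r) = t ^ N * t⁻¹ ^ r := by
      intro t r ht hr
      rw [inv_pow, pow_sub₀ t ht hr]
    apply mul_left_cancel₀ (X_ne_zero (R := k))
    apply Polynomial.funext
    intro t
    by_cases ht : t = 0
    · simp [ht]
    · simp only [eval_mul, eval_add, eval_pow, eval_X]
      rw [hs t m ht (by omega), hs t n ht (by omega), hs t m' ht (by omega), hs t n' ht (by omega)]
      simp only [pow_add]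
      linear_combination t * t ^ N * h t ht
  have hc : ∀ r : ℕ, _ := fun r => congrArg (fun f => coeff f r) key
  simp only [coeff_add, coeff_X_pow] at hc
  have hm : m = m' := by
    rcases lt_trichotomy m m' with hlt | rfl | hlt
    · have := hc (N + m')
      split_ifs at this <;> first | omega | skip
      all_goals exfalso; revert this; simp <;> grind
    · rfl
    · have := hc (N + m)
      split_ifs at this <;> first | omega | skip
      all_goals exfalso; revert this; simp <;> grind
  refine ⟨hm, ?_⟩
  subst hm
  simp only [add_assoc, add_right_inj] at hc
  rcases lt_trichotomy n n' with hlt | rfl | hlt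
  · have := hc (N + n')
    split_ifs at this <;> first | omega | skip
    all_goals exfalso; revert this; simp
  · rfl
  · have := hc (N + n)
    split_ifs at this <;> first | omega | skip
    all_goals exfalso; revert this; simp

lemma weight_injective {p : ℕ} [Fact p.Prime] (hp : 5 ≤ p) :
    Function.Injective (Idx13.weight p) := by
  have hprime : p.Prime := Fact.out
  have hodd : ∀ e, p ^ e % 2 = 1 := fun e =>
    Nat.odd_iff.1 ((hprime.odd_of_ne_two (by omega)).pow)
  have hthree : ∀ e, p ^ e % 3 ≠ 0 := fun e h => by
    have := (Nat.prime_dvd_prime_iff_eq Nat.prime_three hprime).1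
      (Nat.prime_three.dvd_of_dvd_pow (Nat.dvd_of_mod_eq_zero h))
    omega
  have hinj : ∀ {a b}, p ^ a = p ^ b → a = b := fun h => Nat.pow_right_injective (by omega) h
  have hlt : ∀ {a b}, a < b → p ^ a < p ^ b := fun h => Nat.pow_lt_pow_right (by omega) h
  intro i j hij
  cases i <;> cases j <;> simp only [Idx13.weight, Prod.mk.injEq] at hij
  case I.I e e' => rw [hinj hij.2]
  case IV.IV e₁ e₂ h e₁' e₂' h' =>
    have := hlt h
    have := hlt h'
    obtain rfl : e₁ = e₁' := hinj (by omega)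
    obtain rfl : e₂ = e₂' := hinj (by omega)
    rfl
  case IX.IX e e' => rw [hinj (a := e) (b := e') (by omega)]
  case XV.XV e₂ e₃ h e₂' e₃' h' =>
    obtain rfl := hinj hij.1
    obtain rfl := hinj hij.2
    rfl
  case XXIV.XXIV e e' => rw [hinj hij.1]
  case XXVI.XXVI => rfl
  case I.IV e e₁ e₂ h | IV.I e₁ e₂ h e => have := hlt h; have := hodd e₂; omega
  case I.IX e e' | IX.I e e' => have := hodd e; have := hodd e'; omega
  case I.XV e e₂ e₃ h | XV.I e₂ e₃ h e => have := hthree e₂; omega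
  case I.XXIV e e' | XXIV.I e e' => have := hodd e; have := hodd e'; omega
  case I.XXVI e | XXVI.I e => have := hodd e; omega
  case IV.IX e₁ e₂ h e | IX.IV e e₁ e₂ h => have := hlt h; omega
  case IV.XV e₁ e₂ h e₂' e₃ h' | XV.IV e₂' e₃ h' e₁ e₂ h =>
    have := hodd e₁; have := hodd e₂; have := hodd e₂'; omega
  case IV.XXIV e₁ e₂ h e | XXIV.IV e e₁ e₂ h => have := hlt h; omega
  case IV.XXVI e₁ e₂ h | XXVI.IV e₁ e₂ h => have := hlt h; omega
  case IX.XV e e₂ e₃ h | XV.IX e₂ e₃ h e => have := hodd e₃; omega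
  case IX.XXIV e e' | XXIV.IX e' e => have := hodd e'; omega
  case IX.XXVI e | XXVI.IX e => have := hodd e; omega
  case XV.XXIV e₂ e₃ h e | XXIV.XV e e₂ e₃ h => have := hodd e₃; omega
  case XV.XXVI e₂ e₃ h | XXVI.XV e₂ e₃ h => have := hodd e₃; omega
  case XXIV.XXVI e | XXVI.XXIV e => have := hodd e; omega


lemma eq_of_matEquiv_list13 {k : Type*} [Field k] [Infinite k] {p : ℕ} [Fact p.Prime]
    (hp : 5 ≤ p) (h2 : (2 : k) ≠ 0) {i j : Idx13}
    (h : MatEquiv (list13 (k := k) p i) (list13 p j)) : i = j := by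
  have hp0 : 0 < p := by omega
  refine weight_injective hp (Prod.ext_iff.2 (weights_eq_of_trace_eq h2 (weight_snd_le_fst hp0 i)
    (weight_snd_le_fst hp0 j) fun t ht => ?_))
  rw [← trace_list13_torus hp0 i t ht, h.trace_eq, trace_list13_torus hp0 j t ht]

end Uniqueness

/-- For `p ≥ 5`, every homomorphism of algebraic groups
`σ : SL(2,k) → SL(4,k)` is equivalent to exactly one member of the list (I), (IV), (IX),
(XV), (XXIV), (XXVI); in particular distinct members of the list are inequivalent. -/
theorem stmt13 {k : Type*} [Field k] [IsAlgClosed k] {p : ℕ} [Fact p.Prime] [CharP k p]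
    (hp : 5 ≤ p) :
    (∀ σ : SpecialLinearGroup (Fin 2) k →* SpecialLinearGroup (Fin 4) k,
        IsPolyEntries (fun A => (σ A).1) →
          ∃! i : Idx13, MatEquiv (fun A => (σ A).1) (list13 p i)) ∧
      ∀ i j : Idx13, MatEquiv (list13 (k := k) p i) (list13 (k := k) p j) → i = j := by
  have hne : ∀ m : ℕ, 0 < m → m < 5 → (m : k) ≠ 0 := fun m hm hm5 h =>
    absurd (Nat.le_of_dvd hm ((CharP.cast_eq_zero_iff k p m).1 h)) (by omega)
  have h2 : (2 : k) ≠ 0 := by exact_mod_cast hne 2 (by norm_num) (by norm_num)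
  have h3 : (3 : k) ≠ 0 := by exact_mod_cast hne 3 (by norm_num) (by norm_num)
  have huniq : ∀ i j : Idx13, MatEquiv (list13 (k := k) p i) (list13 (k := k) p j) → i = j :=
    fun i j => eq_of_matEquiv_list13 hp h2
  refine ⟨fun σ hσ => ?_, huniq⟩
  obtain ⟨U, hU⟩ := hσ.exists_upperUni
  obtain ⟨i, hi⟩ := four_dimensional p h2 h3 (SpecialLinearGroup.coeMonoidHom.comp σ) U hU
  exact ⟨i, hi, fun j hj => huniq j i (hj.symm.trans hi)⟩
end
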